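/- arXiv:2205.01660 — 6 statements merged into one kernel-verified Lean document; each statement's English description precedes it below -/
import Mathlib

section
/- Let k be a commutative ring, A an associative unital k-algebra, and 1 ≤ m < n integers. If D and D' are [m,n)-integrable k-derivations on A, then D + D' and −D are [m,n)-integrable; that is, the set Der_{[m,n)}(A) of [m,n)-integrable derivations is an additive subgroup of the k-module of all k-derivations on A. The same closure under addition and negation holds for [m,∞]-integrable derivations. -/
/-- A `k`-derivation on an associative unital `k`-algebra `A`: a `k`-linear map
satisfying the Leibniz rule. -/
def IsDerivation (k A : Type*) [CommRing k] [Ring A] [Algebra k A]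
    (D : A →ₗ[k] A) : Prop :=
  ∀ x y : A, D (x * y) = D x * y + x * D y

/-- `D` is `[m,n)`-integrable: there is a family `α_0 = id, α_1, …, α_{n-1}` of
`k`-linear endomorphisms of `A` with `α_i = 0` for `0 < i < m`, `α_m = D`, and
satisfying the Hasse–Schmidt convolution identities for all `i < n`. -/
def IsFinIntegrable (k A : Type*) [CommRing k] [Ring A] [Algebra k A]
    (m n : ℕ) (D : A →ₗ[k] A) : Prop :=
  ∃ α : ℕ → (A →ₗ[k] A),
    α 0 = LinearMap.id ∧
    (∀ i, 0 < i → i < m → α i = 0) ∧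
    α m = D ∧
    ∀ i, i < n → ∀ x y : A,
      α i (x * y) = ∑ j ∈ Finset.range (i + 1), α j x * α (i - j) y

/-- `D` is `[m,∞]`-integrable: an infinite Hasse–Schmidt family exists
(equivalently, an automorphism of `A⟦t⟧` congruent to `1` mod `t^m` with
`t^m`-coefficient `D`). -/
def IsInfIntegrable (k A : Type*) [CommRing k] [Ring A] [Algebra k A]
    (m : ℕ) (D : A →ₗ[k] A) : Prop :=
  ∃ α : ℕ → (A →ₗ[k] A),
    α 0 = LinearMap.id ∧
    (∀ i, 0 < i → i < m → α i = 0) ∧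
    α m = D ∧
    ∀ i, ∀ x y : A,
      α i (x * y) = ∑ j ∈ Finset.range (i + 1), α j x * α (i - j) y

open Finset PowerSeries in
/-- The coefficients of `φ` below `N` satisfy the Hasse–Schmidt convolution identities. -/
def IsHasseSchmidtBelow {k A : Type*} [CommRing k] [Ring A] [Algebra k A]
    (N : ℕ) (φ : (Module.End k A)⟦X⟧) : Prop :=
  ∀ i < N, ∀ x y : A,
    coeff i φ (x * y) = ∑ p ∈ antidiagonal i, coeff p.1 φ x * coeff p.2 φ y

/-- `φ ≡ 1 + D X ^ m` modulo `X ^ (m + 1)`, for `0 < m`. -/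
structure HasLeadingTerm {R : Type*} [Ring R] (m : ℕ) (D : R) (φ : PowerSeries R) : Prop where
  coeff_zero : PowerSeries.coeff 0 φ = 1
  coeff_of_lt : ∀ i, 0 < i → i < m → PowerSeries.coeff i φ = 0
  coeff_eq : PowerSeries.coeff m φ = D

namespace HasLeadingTerm

open Finset PowerSeries

variable {R : Type*} [Ring R] {m : ℕ} {D D' : R} {φ ψ : R⟦X⟧}

theorem coeff_mul_eq_add (hφ : HasLeadingTerm m D φ) (hψ : coeff 0 ψ = 1) {i : ℕ}
    (hi : 0 < i) (him : i ≤ m) : coeff i (φ * ψ) = coeff i φ + coeff i ψ := by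
  rw [coeff_mul, sum_eq_add_of_mem (i, 0) (0, i) (by simp) (by simp) (by simp [hi.ne'])]
  · simp [hφ.coeff_zero, hψ]
  · rintro ⟨a, b⟩ hab ⟨h₁, h₂⟩
    simp only [HasAntidiagonal.mem_antidiagonal, ne_eq, Prod.mk.injEq, not_and] at hab h₁ h₂
    rw [hφ.coeff_of_lt a (by omega) (by omega), zero_mul]

theorem mul (hm : 0 < m) (hφ : HasLeadingTerm m D φ) (hψ : HasLeadingTerm m D' ψ) :
    HasLeadingTerm m (D + D') (φ * ψ) where
  coeff_zero := by simp [coeff_mul, hφ.coeff_zero, hψ.coeff_zero]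
  coeff_of_lt i hi him := by
    rw [hφ.coeff_mul_eq_add hψ.coeff_zero hi him.le, hφ.coeff_of_lt i hi him,
      hψ.coeff_of_lt i hi him, add_zero]
  coeff_eq := by
    rw [hφ.coeff_mul_eq_add hψ.coeff_zero hm le_rfl, hφ.coeff_eq, hψ.coeff_eq]

theorem of_mul_eq_one (hm : 0 < m) (hφ : HasLeadingTerm m D φ) (h : φ * ψ = 1) :
    HasLeadingTerm m (-D) ψ := by
  have h₀ : coeff 0 ψ = 1 := by
    simpa [coeff_mul, hφ.coeff_zero] using congrArg (coeff 0) h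
  have key (i : ℕ) (hi : 0 < i) (him : i ≤ m) : coeff i ψ = -coeff i φ := by
    have := hφ.coeff_mul_eq_add h₀ hi him
    rw [h, coeff_one, if_neg hi.ne'] at this
    exact (neg_eq_of_add_eq_zero_right this.symm).symm
  refine ⟨h₀, fun i hi him => ?_, ?_⟩
  · rw [key i hi him.le, hφ.coeff_of_lt i hi him, neg_zero]
  · rw [key m hm le_rfl, hφ.coeff_eq]

theorem exists_mul_eq_one (hφ : HasLeadingTerm m D φ) : ∃ ψ : R⟦X⟧, φ * ψ = 1 :=
  ⟨invOfUnit φ 1, mul_invOfUnit φ 1 (by simpa using hφ.coeff_zero)⟩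

end HasLeadingTerm

namespace IsHasseSchmidtBelow

open Finset PowerSeries

variable {k A : Type*} [CommRing k] [Ring A] [Algebra k A] {N : ℕ}
  {φ ψ : (Module.End k A)⟦X⟧}

theorem sum_coeff_apply_sum (hφ : IsHasseSchmidtBelow N φ) (ψ : (Module.End k A)⟦X⟧)
    {i : ℕ} (hi : i < N) (x y : A) :
    ∑ p ∈ antidiagonal i,
        coeff p.1 φ (∑ q ∈ antidiagonal p.2, coeff q.1 ψ x * coeff q.2 ψ y) =
      ∑ p ∈ antidiagonal i, coeff p.1 (φ * ψ) x * coeff p.2 (φ * ψ) y := by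
  have expand : ∀ p ∈ antidiagonal i,
      coeff p.1 φ (∑ q ∈ antidiagonal p.2, coeff q.1 ψ x * coeff q.2 ψ y) =
        ∑ r ∈ antidiagonal p.2 ×ˢ antidiagonal p.1,
          coeff r.2.1 φ (coeff r.1.1 ψ x) * coeff r.2.2 φ (coeff r.1.2 ψ y) := by
    intro p hp
    rw [map_sum, sum_product]
    exact sum_congr rfl fun q _ => hφ _ ((HasAntidiagonal.antidiagonal.fst_le hp).trans_lt hi) _ _
  rw [sum_congr rfl expand]
  simp only [coeff_mul, LinearMap.sum_apply, Module.End.mul_apply, sum_mul_sum, ← sum_product']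
  rw [sum_sigma', sum_sigma']
  refine sum_bij'
    (fun r _ => ⟨(r.2.2.1 + r.2.1.1, r.2.2.2 + r.2.1.2),
      ((r.2.2.1, r.2.1.1), (r.2.2.2, r.2.1.2))⟩)
    (fun r _ => ⟨(r.2.1.1 + r.2.2.1, r.2.1.2 + r.2.2.2),
      ((r.2.1.2, r.2.2.2), (r.2.1.1, r.2.2.1))⟩) ?_ ?_ ?_ ?_ ?_
  · rintro ⟨⟨a, b⟩, ⟨c, d⟩, ⟨e, f⟩⟩ h
    simp only [mem_sigma, mem_product, HasAntidiagonal.mem_antidiagonal, and_true] at h ⊢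
    omega
  · rintro ⟨⟨a, b⟩, ⟨c, d⟩, ⟨e, f⟩⟩ h
    simp only [mem_sigma, mem_product, HasAntidiagonal.mem_antidiagonal, and_true] at h ⊢
    omega
  · rintro ⟨⟨a, b⟩, ⟨c, d⟩, ⟨e, f⟩⟩ h
    simp only [mem_sigma, mem_product, HasAntidiagonal.mem_antidiagonal] at h
    obtain ⟨-, rfl, rfl⟩ := h
    rfl
  · rintro ⟨⟨a, b⟩, ⟨c, d⟩, ⟨e, f⟩⟩ h
    simp only [mem_sigma, mem_product, HasAntidiagonal.mem_antidiagonal] at h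
    obtain ⟨-, rfl, rfl⟩ := h
    rfl
  · intros
    rfl

theorem mul (hφ : IsHasseSchmidtBelow N φ) (hψ : IsHasseSchmidtBelow N ψ) :
    IsHasseSchmidtBelow N (φ * ψ) := by
  intro i hi x y
  rw [← hφ.sum_coeff_apply_sum ψ hi, coeff_mul, LinearMap.sum_apply]
  refine sum_congr rfl fun p hp => ?_
  rw [Module.End.mul_apply, hψ _ ((HasAntidiagonal.antidiagonal.snd_le hp).trans_lt hi)]

theorem one : IsHasseSchmidtBelow N (1 : (Module.End k A)⟦X⟧) := by
  rintro (_ | i) - x y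
  · simp
  · rw [coeff_one, if_neg i.succ_ne_zero, LinearMap.zero_apply, sum_eq_zero]
    rintro ⟨a, b⟩ hab
    rw [HasAntidiagonal.mem_antidiagonal] at hab
    obtain ha | hb : a ≠ 0 ∨ b ≠ 0 := by omega
    · simp [coeff_one, ha]
    · simp [coeff_one, hb]

theorem of_mul_eq_one (hφ : IsHasseSchmidtBelow N φ) (h₀ : coeff 0 φ = 1) (h : φ * ψ = 1) :
    IsHasseSchmidtBelow N ψ := by
  intro i
  induction i using Nat.strong_induction_on with
  | _ i ih =>
    intro hi x y
    have key : ∑ p ∈ antidiagonal i, coeff p.1 φ (coeff p.2 ψ (x * y)) =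
        ∑ p ∈ antidiagonal i,
          coeff p.1 φ (∑ q ∈ antidiagonal p.2, coeff q.1 ψ x * coeff q.2 ψ y) := by
      rw [hφ.sum_coeff_apply_sum ψ hi, h, ← one i hi, ← h, coeff_mul, LinearMap.sum_apply]
      rfl
    have hmem : (0, i) ∈ antidiagonal i := by simp
    rw [← add_sum_erase _ _ hmem, ← add_sum_erase _ _ hmem] at key
    rw [sum_congr rfl (g := fun p : ℕ × ℕ =>
      coeff p.1 φ (∑ q ∈ antidiagonal p.2, coeff q.1 ψ x * coeff q.2 ψ y))] at key
    · simpa only [h₀, Module.End.one_apply, add_left_inj] using key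
    · rintro ⟨a, b⟩ hab
      simp only [mem_erase, ne_eq, Prod.mk.injEq, not_and, HasAntidiagonal.mem_antidiagonal] at hab
      rw [ih b (by omega) (by omega)]

end IsHasseSchmidtBelow

section Integrable

open Finset PowerSeries

variable {k A : Type*} [CommRing k] [Ring A] [Algebra k A] {m n : ℕ} {D : A →ₗ[k] A}

theorem isFinIntegrable_iff_exists_powerSeries :
    IsFinIntegrable k A m n D ↔ ∃ φ : (Module.End k A)⟦X⟧,
      HasLeadingTerm m (D : Module.End k A) φ ∧ IsHasseSchmidtBelow n φ := by
  constructor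
  · rintro ⟨α, h₀, hlt, hm, hmul⟩
    refine ⟨mk α, ⟨by simpa [Module.End.one_eq_id] using h₀, by simpa using hlt,
      by simpa using hm⟩, fun i hi x y => ?_⟩
    simpa [Nat.sum_antidiagonal_eq_sum_range_succ_mk] using hmul i hi x y
  · rintro ⟨φ, ⟨h₀, hlt, hm⟩, hmul⟩
    refine ⟨fun i => coeff i φ, h₀, hlt, hm, fun i hi x y => ?_⟩
    simpa [Nat.sum_antidiagonal_eq_sum_range_succ_mk] using hmul i hi x y

theorem isInfIntegrable_iff_exists_powerSeries :
    IsInfIntegrable k A m D ↔ ∃ φ : (Module.End k A)⟦X⟧,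
      HasLeadingTerm m (D : Module.End k A) φ ∧ ∀ N, IsHasseSchmidtBelow N φ := by
  constructor
  · rintro ⟨α, h₀, hlt, hm, hmul⟩
    refine ⟨mk α, ⟨by simpa [Module.End.one_eq_id] using h₀, by simpa using hlt,
      by simpa using hm⟩, fun _ i _ x y => ?_⟩
    simpa [Nat.sum_antidiagonal_eq_sum_range_succ_mk] using hmul i x y
  · rintro ⟨φ, ⟨h₀, hlt, hm⟩, hmul⟩
    refine ⟨fun i => coeff i φ, h₀, hlt, hm, fun i x y => ?_⟩
    simpa [Nat.sum_antidiagonal_eq_sum_range_succ_mk] using hmul _ i i.lt_succ_self x y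

end Integrable

/-- The `[m,n)`-integrable derivations are closed under addition and negation,
and likewise for `[m,∞]`-integrable derivations. -/
theorem statement0 (k A : Type*) [CommRing k] [Ring A] [Algebra k A]
    (m n : ℕ) (hm : 1 ≤ m) (hmn : m < n)
    (D D' : A →ₗ[k] A) (hD : IsDerivation k A D) (hD' : IsDerivation k A D') :
    (IsFinIntegrable k A m n D → IsFinIntegrable k A m n D' →
      IsFinIntegrable k A m n (D + D') ∧ IsFinIntegrable k A m n (-D)) ∧
    (IsInfIntegrable k A m D → IsInfIntegrable k A m D' →
      IsInfIntegrable k A m (D + D') ∧ IsInfIntegrable k A m (-D)) := by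
  simp only [isFinIntegrable_iff_exists_powerSeries, isInfIntegrable_iff_exists_powerSeries]
  constructor
  · rintro ⟨φ, hφ, hφ'⟩ ⟨ψ, hψ, hψ'⟩
    obtain ⟨χ, hχ⟩ := hφ.exists_mul_eq_one
    exact ⟨⟨φ * ψ, hφ.mul hm hψ, hφ'.mul hψ'⟩,
      ⟨χ, hφ.of_mul_eq_one hm hχ, hφ'.of_mul_eq_one hφ.coeff_zero hχ⟩⟩
  · rintro ⟨φ, hφ, hφ'⟩ ⟨ψ, hψ, hψ'⟩
    obtain ⟨χ, hχ⟩ := hφ.exists_mul_eq_one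
    exact ⟨⟨φ * ψ, hφ.mul hm hψ, fun N => (hφ' N).mul (hψ' N)⟩,
      ⟨χ, hφ.of_mul_eq_one hm hχ, fun N => (hφ' N).of_mul_eq_one hφ.coeff_zero hχ⟩⟩
end

section
/- Let k be a commutative ring, A an associative unital k-algebra, and 1 ≤ n an integer with 1 < n. If D is a [1,n)-integrable k-derivation on A and z is an element of the centre Z(A) of A, then the map zD : x ↦ z·D(x) is again a k-derivation on A and is [1,n)-integrable; that is, Der_{[1,n)}(A) is a Z(A)-submodule of Der(A). (A witnessing family is given by β_i = z^i α_i for a witnessing family (α_i) for D.) -/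
/-- `Der_{[1,n)}(A)` is a `Z(A)`-submodule of `Der(A)`: for a central element `z`
and a `[1,n)`-integrable derivation `D`, the map `x ↦ z * D x` is again a
`[1,n)`-integrable derivation. -/
theorem statement1 (k A : Type*) [CommRing k] [Ring A] [Algebra k A]
    (n : ℕ) (hn : 1 < n)
    (D : A →ₗ[k] A) (hD : IsDerivation k A D) (hint : IsFinIntegrable k A 1 n D)
    (z : A) (hz : ∀ a : A, z * a = a * z) :
    IsDerivation k A (LinearMap.mulLeft k z ∘ₗ D) ∧
    IsFinIntegrable k A 1 n (LinearMap.mulLeft k z ∘ₗ D) := by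
  refine ⟨fun x y => ?_, ?_⟩
  · simp only [LinearMap.comp_apply, LinearMap.mulLeft_apply, hD x y, mul_add, ← mul_assoc, hz x]
  · obtain ⟨α, h0, -, h1, hα⟩ := hint
    refine ⟨fun i => LinearMap.mulLeft k (z ^ i) ∘ₗ α i, ?_, fun i _ _ => by omega, ?_, ?_⟩
    · simp [h0]
    · simp [h1]
    · intro i hi x y
      simp only [LinearMap.comp_apply, LinearMap.mulLeft_apply, hα i hi, Finset.mul_sum]
      refine Finset.sum_congr rfl fun j hj => ?_
      have hji : j + (i - j) = i := by
        have := Finset.mem_range.mp hj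
        omega
      have hcomm : Commute (z ^ (i - j)) (α j x) := Commute.pow_left (hz _) _
      calc z ^ i * (α j x * α (i - j) y)
          = z ^ j * (z ^ (i - j) * α j x) * α (i - j) y := by
            rw [← mul_assoc (z ^ j), ← pow_add, hji, mul_assoc]
        _ = z ^ j * α j x * (z ^ (i - j) * α (i - j) y) := by
            rw [hcomm.eq]
            simp only [mul_assoc]
end

section
/- Let k be a commutative ring, A an associative unital k-algebra, and m, m', n positive integers with m + m' < n. If D is an [m,n)-integrable k-derivation and D' is an [m',n)-integrable k-derivation on A, then the commutator [D,D'] = D∘D' − D'∘D (which is again a k-derivation) is [m+m',n)-integrable. -/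
open PowerSeries Finset in
/-- The action of a power series of endomorphisms of `A` on power series over `A`. -/
noncomputable def endAct {k A : Type*} [CommRing k] [Ring A] [Algebra k A]
    (a : PowerSeries (Module.End k A)) (f : PowerSeries A) : PowerSeries A :=
  PowerSeries.mk fun i => ∑ p ∈ antidiagonal i, coeff p.1 a (coeff p.2 f)

/-- A power series of endomorphisms is multiplicative modulo `t ^ n`. -/
def IsMulMod {k A : Type*} [CommRing k] [Ring A] [Algebra k A]
    (n : ℕ) (a : PowerSeries (Module.End k A)) : Prop :=
  ∀ f g : PowerSeries A, ∀ i < n,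
    PowerSeries.coeff i (endAct a (f * g)) = PowerSeries.coeff i (endAct a f * endAct a g)

section

open PowerSeries Finset

variable {k A : Type*} [CommRing k] [Ring A] [Algebra k A]

lemma coeff_endAct (a : PowerSeries (Module.End k A)) (f : PowerSeries A) (i : ℕ) :
    coeff i (endAct a f) = ∑ p ∈ antidiagonal i, coeff p.1 a (coeff p.2 f) :=
  coeff_mk _ _

lemma endAct_one (f : PowerSeries A) : endAct (1 : PowerSeries (Module.End k A)) f = f := by
  ext i
  rw [coeff_endAct, Finset.sum_eq_single (0, i)]
  · simp
  · rintro ⟨p, q⟩ hp hne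
    have : p ≠ 0 := by
      rintro rfl
      simp_all
    simp [coeff_one, this]
  · simp

lemma endAct_mul (a b : PowerSeries (Module.End k A)) (f : PowerSeries A) :
    endAct (a * b) f = endAct a (endAct b f) := by
  ext i
  simp only [coeff_endAct, coeff_mul, LinearMap.sum_apply, Module.End.mul_apply, map_sum]
  rw [Finset.sum_sigma', Finset.sum_sigma']
  exact Finset.sum_nbij' (fun x => ⟨(x.2.1, x.2.2 + x.1.2), (x.2.2, x.1.2)⟩)
    (fun x => ⟨(x.1.1 + x.2.1, x.2.2), (x.1.1, x.2.1)⟩)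
    (by rintro ⟨⟨_, _⟩, ⟨_, _⟩⟩; simp; omega) (by rintro ⟨⟨_, _⟩, ⟨_, _⟩⟩; simp; omega)
    (by rintro ⟨⟨_, _⟩, ⟨_, _⟩⟩; simp +contextual) (by rintro ⟨⟨_, _⟩, ⟨_, _⟩⟩; simp +contextual)
    (by simp)

/-- The coefficients of `endAct a f` below `n` depend only on those of `f`. -/
lemma coeff_endAct_congr (a : PowerSeries (Module.End k A)) {f g : PowerSeries A} {n : ℕ}
    (h : ∀ i < n, coeff i f = coeff i g) : ∀ i < n, coeff i (endAct a f) = coeff i (endAct a g) := by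
  intro i hi
  rw [coeff_endAct, coeff_endAct]
  refine Finset.sum_congr rfl fun p hp => ?_
  rw [h p.2 (by have := mem_antidiagonal.mp hp; omega)]

lemma IsMulMod.mul {n : ℕ} {a b : PowerSeries (Module.End k A)}
    (ha : IsMulMod n a) (hb : IsMulMod n b) : IsMulMod n (a * b) := by
  intro f g i hi
  rw [endAct_mul, endAct_mul, endAct_mul, coeff_endAct_congr a (hb f g) i hi, ha _ _ i hi]

lemma IsMulMod.of_mul_eq_one {n : ℕ} {a b : PowerSeries (Module.End k A)}
    (ha : IsMulMod n a) (hab : a * b = 1) (hba : b * a = 1) : IsMulMod n b := by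
  intro f g i hi
  have key := coeff_endAct_congr b (ha (endAct b f) (endAct b g)) i hi
  rw [← endAct_mul, hba, endAct_one, ← endAct_mul, ← endAct_mul, hab, endAct_one,
    endAct_one] at key
  exact key.symm

lemma isMulMod_of_forall_coeff {n : ℕ} {a : PowerSeries (Module.End k A)}
    (h : ∀ i < n, ∀ x y : A,
      coeff i a (x * y) = ∑ p ∈ antidiagonal i, coeff p.1 a x * coeff p.2 a y) :
    IsMulMod n a := by
  intro f g i hi
  have expand : ∀ p ∈ antidiagonal i, coeff p.1 a (coeff p.2 (f * g)) =
      ∑ r ∈ antidiagonal p.2, ∑ s ∈ antidiagonal p.1,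
        coeff s.1 a (coeff r.1 f) * coeff s.2 a (coeff r.2 g) := by
    intro p hp
    rw [coeff_mul, map_sum]
    exact Finset.sum_congr rfl fun r _ =>
      h _ (by have := mem_antidiagonal.mp hp; omega) _ _
  rw [coeff_endAct, Finset.sum_congr rfl expand, coeff_mul]
  simp only [coeff_endAct, Finset.sum_mul_sum]
  simp only [← Finset.sum_product', Finset.sum_sigma']
  exact Finset.sum_nbij'
    (fun x => ⟨(x.2.2.1 + x.2.1.1, x.2.2.2 + x.2.1.2),
      ((x.2.2.1, x.2.1.1), (x.2.2.2, x.2.1.2))⟩)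
    (fun x => ⟨(x.2.1.1 + x.2.2.1, x.2.1.2 + x.2.2.2),
      ((x.2.1.2, x.2.2.2), (x.2.1.1, x.2.2.1))⟩)
    (by rintro ⟨⟨_, _⟩, ⟨⟨_, _⟩, ⟨_, _⟩⟩⟩; simp; omega)
    (by rintro ⟨⟨_, _⟩, ⟨⟨_, _⟩, ⟨_, _⟩⟩⟩; simp; omega)
    (by rintro ⟨⟨_, _⟩, ⟨⟨_, _⟩, ⟨_, _⟩⟩⟩; simp +contextual)
    (by rintro ⟨⟨_, _⟩, ⟨⟨_, _⟩, ⟨_, _⟩⟩⟩; simp +contextual)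
    (by simp)

lemma coeff_endAct_C (a : PowerSeries (Module.End k A)) (x : A) (i : ℕ) :
    coeff i (endAct a (C x)) = coeff i a x := by
  rw [coeff_endAct, Finset.sum_eq_single (i, 0)]
  · simp
  · rintro ⟨p, q⟩ hp hne
    have : q ≠ 0 := by
      rintro rfl
      simp_all
    simp [coeff_C, this]
  · simp

lemma IsMulMod.coeff_apply_mul {n : ℕ} {a : PowerSeries (Module.End k A)}
    (ha : IsMulMod n a) {i : ℕ} (hi : i < n) (x y : A) :
    coeff i a (x * y) = ∑ p ∈ antidiagonal i, coeff p.1 a x * coeff p.2 a y := by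
  have := ha (C x) (C y) i hi
  rw [← map_mul, coeff_endAct_C, coeff_mul] at this
  simpa only [coeff_endAct_C] using this

/-- An `[m,n)`-integral of `D`, packaged as a power series `1 + t ^ m * a'`. -/
lemma IsFinIntegrable.exists_powerSeries {m n : ℕ} (hm : 0 < m) {D : A →ₗ[k] A}
    (h : IsFinIntegrable k A m n D) :
    ∃ a' : PowerSeries (Module.End k A), constantCoeff a' = D ∧ IsMulMod n (1 + X ^ m * a') := by
  obtain ⟨α, h0, hz, hD, hmul⟩ := h
  have hdvd : (X : PowerSeries (Module.End k A)) ^ m ∣ PowerSeries.mk α - 1 := by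
    rw [X_pow_dvd_iff]
    intro i hi
    rcases Nat.eq_zero_or_pos i with rfl | hpos
    · simpa [sub_eq_zero, Module.End.one_eq_id] using h0
    · simp [coeff_one, hz i hpos hi, hpos.ne']
  obtain ⟨a', ha'⟩ := hdvd
  refine ⟨a', ?_, ?_⟩
  · have := congrArg (coeff m) ha'
    rw [← coeff_zero_eq_constantCoeff_apply]
    simpa [coeff_X_pow_mul', coeff_one, hm.ne', hD] using this.symm
  · rw [← ha', add_sub_cancel]
    refine isMulMod_of_forall_coeff fun i hi x y => ?_
    simp only [coeff_mk]
    rw [hmul i hi,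
      Finset.Nat.sum_antidiagonal_eq_sum_range_succ (fun p q => α p x * α q y)]

lemma IsMulMod.isFinIntegrable {m n : ℕ} (hm : 0 < m) {c : PowerSeries (Module.End k A)}
    (h : IsMulMod n (1 + X ^ m * c)) : IsFinIntegrable k A m n (constantCoeff c) := by
  refine ⟨fun i => coeff i (1 + X ^ m * c), ?_, ?_, ?_, ?_⟩
  · simp [hm.ne', Module.End.one_eq_id]
  · intro i hi him
    simp [coeff_one, hi.ne', coeff_X_pow_mul', him.not_ge]
  · simp [coeff_one, hm.ne', coeff_X_pow_mul']
  · intro i hi x y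
    exact (h.coeff_apply_mul hi x y).trans
      (Finset.Nat.sum_antidiagonal_eq_sum_range_succ_mk _ _)

lemma exists_inverse_of_constantCoeff_eq_one {R : Type*} [Ring R] (a : PowerSeries R)
    (ha : constantCoeff a = 1) :
    ∃ b : PowerSeries R, a * b = 1 ∧ b * a = 1 ∧ constantCoeff b = 1 := by
  have hab : a * invOfUnit a 1 = 1 := mul_invOfUnit a 1 (by simpa using ha)
  have hba : invOfUnit a 1 * a = 1 := invOfUnit_mul a 1 (by simpa using ha)
  exact ⟨_, hab, hba, by simp⟩

lemma IsDerivation.commutator {D D' : A →ₗ[k] A} (hD : IsDerivation k A D)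
    (hD' : IsDerivation k A D') : IsDerivation k A (D ∘ₗ D' - D' ∘ₗ D) := by
  intro x y
  simp only [LinearMap.sub_apply, LinearMap.comp_apply, hD x y, hD' x y, map_add, hD _ _, hD' _ _]
  noncomm_ring

end

/-- If `D` is `[m,n)`-integrable and `D'` is `[m',n)`-integrable, then the
commutator `[D,D'] = D ∘ D' - D' ∘ D` is again a derivation and is
`[m+m',n)`-integrable. -/
theorem statement3 (k A : Type*) [CommRing k] [Ring A] [Algebra k A]
    (m m' n : ℕ) (hm : 0 < m) (hm' : 0 < m') (hmn : m + m' < n)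
    (D D' : A →ₗ[k] A) (hD : IsDerivation k A D) (hD' : IsDerivation k A D')
    (h1 : IsFinIntegrable k A m n D) (h2 : IsFinIntegrable k A m' n D') :
    IsDerivation k A (D ∘ₗ D' - D' ∘ₗ D) ∧
    IsFinIntegrable k A (m + m') n (D ∘ₗ D' - D' ∘ₗ D) := by
  obtain ⟨a, ha0, ha⟩ := h1.exists_powerSeries hm
  obtain ⟨b, hb0, hb⟩ := h2.exists_powerSeries hm'
  refine ⟨hD.commutator hD', ?_⟩
  set X := (PowerSeries.X : PowerSeries (Module.End k A))
  obtain ⟨u, hau, hua, hu⟩ := exists_inverse_of_constantCoeff_eq_one (1 + X ^ m * a)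
    (by simp [X, hm.ne'])
  obtain ⟨v, hbv, hvb, hv⟩ := exists_inverse_of_constantCoeff_eq_one (1 + X ^ m' * b)
    (by simp [X, hm'.ne'])
  have comm_X (i : ℕ) (c : PowerSeries (Module.End k A)) : c * X ^ i = X ^ i * c :=
    ((PowerSeries.commute_X c).pow_right i).eq
  have hab : X ^ m * a * (X ^ m' * b) = X ^ (m + m') * (a * b) := by
    rw [mul_assoc, ← mul_assoc a, comm_X, pow_add]
    simp only [mul_assoc]
  have hba : X ^ m' * b * (X ^ m * a) = X ^ (m + m') * (b * a) := by
    rw [mul_assoc, ← mul_assoc b, comm_X, add_comm, pow_add]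
    simp only [mul_assoc]
  have hcomm : (1 + X ^ m * a) * (1 + X ^ m' * b) =
      (1 + X ^ m' * b) * (1 + X ^ m * a) + X ^ (m + m') * (a * b - b * a) := by
    rw [mul_sub, ← hab, ← hba]
    noncomm_ring
  have hgroup : (1 + X ^ m * a) * (1 + X ^ m' * b) * (u * v) =
      1 + X ^ (m + m') * ((a * b - b * a) * (u * v)) := by
    rw [hcomm, add_mul, mul_assoc (1 + X ^ m' * b), ← mul_assoc _ u, hau, one_mul, hbv, mul_assoc]
  have hmulMod := (ha.mul hb).mul ((ha.of_mul_eq_one hau hua).mul (hb.of_mul_eq_one hbv hvb))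
  rw [hgroup] at hmulMod
  have := hmulMod.isFinIntegrable (by omega)
  simpa [ha0, hb0, hu, hv, Module.End.mul_eq_comp] using this
end

section
/- Let k be a field of characteristic p > 0, A an associative unital k-algebra, and m, n positive integers with pm < n. If D is an [m,n)-integrable k-derivation on A, then the p-fold composite D^p = D∘⋯∘D (which is again a k-derivation, since char k = p) is [pm,n)-integrable. -/
open PowerSeries Finset

/-- A power series `∑ αᵢ tⁱ` with coefficients in `End_k(A)` is multiplicative up to order `n`
if its coefficients satisfy the Hasse–Schmidt identities in all degrees below `n`. -/
def IsHasseSchmidt {k A : Type*} [CommRing k] [Ring A] [Algebra k A]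
    (n : ℕ) (φ : (Module.End k A)⟦X⟧) : Prop :=
  ∀ i < n, ∀ x y : A, coeff i φ (x * y) =
    ∑ q ∈ antidiagonal i, coeff q.1 φ x * coeff q.2 φ y

namespace IsHasseSchmidt

variable {k A : Type*} [CommRing k] [Ring A] [Algebra k A] {n : ℕ}
  {φ ψ : (Module.End k A)⟦X⟧}

lemma one : IsHasseSchmidt n (1 : (Module.End k A)⟦X⟧) := by
  intro i _ x y
  rcases Nat.eq_zero_or_pos i with rfl | hi
  · simp
  · rw [sum_eq_zero]
    · simp [coeff_one, hi.ne']
    · rintro ⟨a, b⟩ hab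
      rw [HasAntidiagonal.mem_antidiagonal] at hab
      rcases Nat.eq_zero_or_pos a with rfl | ha
      · have hb : b ≠ 0 := by simp at hab; omega
        simp [coeff_one, hb]
      · simp [coeff_one, ha.ne']

lemma mul (hφ : IsHasseSchmidt n φ) (hψ : IsHasseSchmidt n ψ) : IsHasseSchmidt n (φ * ψ) := by
  intro i hi x y
  have expand : ∀ q ∈ antidiagonal i, coeff q.1 φ (coeff q.2 ψ (x * y)) =
      ∑ c ∈ antidiagonal q.2, ∑ e ∈ antidiagonal q.1,
        coeff e.1 φ (coeff c.1 ψ x) * coeff e.2 φ (coeff c.2 ψ y) := by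
    intro q hq
    rw [HasAntidiagonal.mem_antidiagonal] at hq
    rw [hψ q.2 (by omega), map_sum]
    exact sum_congr rfl fun c _ => hφ q.1 (by omega) _ _
  simp only [coeff_mul, LinearMap.sum_apply, Module.End.mul_apply, sum_mul_sum]
  rw [sum_congr rfl expand]
  simp only [sum_sigma']
  refine sum_nbij'
    (fun ⟨_, c, e⟩ => ⟨(e.1 + c.1, e.2 + c.2), (e.1, c.1), (e.2, c.2)⟩)
    (fun ⟨_, u, w⟩ => ⟨(u.1 + w.1, u.2 + w.2), (u.2, w.2), (u.1, w.1)⟩)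
    ?_ ?_ ?_ ?_ ?_
  all_goals
    rintro ⟨⟨_, _⟩, ⟨_, _⟩, ⟨_, _⟩⟩ h
    simp only [mem_sigma, HasAntidiagonal.mem_antidiagonal] at h
    obtain ⟨h₁, h₂, h₃⟩ := h
    subst h₁ h₂ h₃
    simp [add_comm, add_left_comm]

lemma pow (hφ : IsHasseSchmidt n φ) : ∀ r : ℕ, IsHasseSchmidt n (φ ^ r)
  | 0 => by simpa using one
  | r + 1 => by simpa only [pow_succ] using (pow hφ r).mul hφ

end IsHasseSchmidt

/-- In prime characteristic `p`, the `p`-th power of `1 + X ^ m * v` is `1 + X ^ (p * m) * v ^ p`,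
for power series with possibly noncommuting coefficients. -/
lemma one_add_X_pow_mul_pow_prime {R : Type*} [Ring R] {p : ℕ} (hp : p.Prime)
    (hR : (p : R⟦X⟧) = 0) (m : ℕ) (v : R⟦X⟧) :
    (1 + X ^ m * v) ^ p = 1 + X ^ (p * m) * v ^ p := by
  rw [(Commute.one_left (X ^ m * v)).add_pow_prime_eq hp, hR, one_pow,
    ((commute_X_pow v m).symm).mul_pow, ← pow_mul, mul_comm m p]
  simp

/-- Over a field of characteristic `p > 0`, if `D` is an `[m,n)`-integrable
derivation then the `p`-fold composite `D^p` is again a derivation and is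
`[pm,n)`-integrable. -/
theorem statement4 (k : Type*) [Field k] (p : ℕ) (hp : 0 < p) [CharP k p]
    (A : Type*) [Ring A] [Algebra k A]
    (m n : ℕ) (hm : 0 < m) (hpmn : p * m < n)
    (D : A →ₗ[k] A) (hD : IsDerivation k A D)
    (hint : IsFinIntegrable k A m n D) :
    IsDerivation k A (D ^ p) ∧ IsFinIntegrable k A (p * m) n (D ^ p) := by
  obtain ⟨α, h0, hlt, hDm, hmul⟩ := hint
  have hprime : p.Prime := CharP.char_prime_of_ne_zero k hp.ne'
  have hpm : 0 < p * m := Nat.mul_pos hp hm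
  let φ : (Module.End k A)⟦X⟧ := PowerSeries.mk α
  let v : (Module.End k A)⟦X⟧ := PowerSeries.mk fun i => α (i + m)
  have hφ : IsHasseSchmidt n φ := by
    intro i hi x y
    rw [Nat.sum_antidiagonal_eq_sum_range_succ (fun a b => coeff a φ x * coeff b φ y)]
    simpa [φ] using hmul i hi x y
  have hφv : φ = 1 + X ^ m * v := by
    ext1 i
    rw [map_add, coeff_X_pow_mul', coeff_one]
    by_cases him : m ≤ i
    · simp [φ, v, him, show i ≠ 0 by omega]
    · rcases Nat.eq_zero_or_pos i with rfl | hi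
      · simpa [φ, hm.ne', Module.End.one_eq_id] using h0
      · simpa [φ, him, hi.ne'] using hlt i hi (by omega)
  have hchar : (p : (Module.End k A)⟦X⟧) = 0 := by
    rw [← map_natCast (algebraMap k (Module.End k A)⟦X⟧), CharP.cast_eq_zero, map_zero]
  have hpow : φ ^ p = 1 + X ^ (p * m) * v ^ p := by
    rw [hφv, one_add_X_pow_mul_pow_prime hprime hchar]
  have hβ0 : coeff 0 (φ ^ p) = LinearMap.id := by
    rw [hpow, map_add, coeff_X_pow_mul', if_neg (by omega)]
    simp [Module.End.one_eq_id]
  have hβlt : ∀ i, 0 < i → i < p * m → coeff i (φ ^ p) = 0 := by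
    intro i hi him
    rw [hpow, map_add, coeff_X_pow_mul', if_neg (by omega), coeff_one, if_neg hi.ne', add_zero]
  have hβD : coeff (p * m) (φ ^ p) = D ^ p := by
    rw [hpow, map_add, coeff_X_pow_mul', if_pos le_rfl, coeff_one, if_neg hpm.ne', Nat.sub_self,
      coeff_zero_eq_constantCoeff_apply, map_pow, ← coeff_zero_eq_constantCoeff_apply]
    simp [v, hDm]
  have hβ : ∀ i, i < n → ∀ x y : A, coeff i (φ ^ p) (x * y) =
      ∑ j ∈ range (i + 1), coeff j (φ ^ p) x * coeff (i - j) (φ ^ p) y := by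
    intro i hi x y
    rw [hφ.pow p i hi,
      Nat.sum_antidiagonal_eq_sum_range_succ (fun a b => coeff a (φ ^ p) x * coeff b (φ ^ p) y)]
  refine ⟨fun x y => ?_, fun i => coeff i (φ ^ p), hβ0, hβlt, hβD, hβ⟩
  have key := hβ (p * m) hpmn x y
  rw [sum_range_succ, sum_eq_single_of_mem 0 (by simpa using hpm)] at key
  · rw [Nat.sub_self, Nat.sub_zero, hβ0, hβD] at key
    rw [key, LinearMap.id_apply, LinearMap.id_apply, add_comm]
  · intro j hj hj0
    rw [hβlt j (Nat.pos_of_ne_zero hj0) (mem_range.mp hj), LinearMap.zero_apply, zero_mul]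
end

section
/- Let k be a commutative Noetherian ring and A an associative unital k-algebra that is finitely generated as a k-module, and let 1 ≤ m < n be integers. A k-derivation D on A is [m,n)-integrable if and only if for every prime number p, the induced k_p-linear derivation D ⊗ id on A_p = A ⊗_ℤ ℤ_(p) is [m,n)-integrable, where ℤ_(p) denotes the localization of ℤ at the prime p and k_p = k ⊗_ℤ ℤ_(p). -/
open TensorProduct

/-- For a prime number `p`, the ideal `(p) ⊆ ℤ` is prime. -/
theorem intSpanPrime (p : ℕ) (hp : p.Prime) : (Ideal.span {(p : ℤ)}).IsPrime :=
  (Ideal.span_singleton_prime (by exact_mod_cast hp.ne_zero)).mpr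
    (Nat.prime_iff_prime_int.mp hp)

/-- `ℤ_(p)`, the localization of the integers at the prime ideal `(p)`. -/
abbrev ZLoc (p : ℕ) (hp : p.Prime) : Type :=
  Localization (@Ideal.primeCompl ℤ _ (Ideal.span {(p : ℤ)}) (intSpanPrime p hp))

/-- `k_p = k ⊗_ℤ ℤ_(p)` (with the `ℤ`-module structures coming from the
`ℤ`-algebra structures, to avoid instance diamonds). -/
abbrev Kp (k : Type*) [CommRing k] (p : ℕ) (hp : p.Prime) : Type _ :=
  @TensorProduct ℤ _ k (ZLoc p hp) _ _ Algebra.toModule Algebra.toModule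

namespace HasseSchmidt

open PowerSeries Finset

section Series

variable {k A : Type*} [CommRing k] [Ring A] [Algebra k A]

/-- The action of a power series of endomorphisms of `A` on `A⟦X⟧`. -/
noncomputable def act (f : (Module.End k A)⟦X⟧) (a : A⟦X⟧) : A⟦X⟧ :=
  PowerSeries.mk fun i => ∑ p ∈ antidiagonal i, coeff p.1 f (coeff p.2 a)

theorem coeff_act (f : (Module.End k A)⟦X⟧) (a : A⟦X⟧) (i : ℕ) :
    coeff i (act f a) = ∑ p ∈ antidiagonal i, coeff p.1 f (coeff p.2 a) :=
  coeff_mk _ _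

theorem coeff_act_congr (f : (Module.End k A)⟦X⟧) {a b : A⟦X⟧} {i : ℕ}
    (h : ∀ j ≤ i, coeff j a = coeff j b) : coeff i (act f a) = coeff i (act f b) := by
  rw [coeff_act, coeff_act]
  refine sum_congr rfl fun p hp => ?_
  rw [h _ (HasAntidiagonal.mem_antidiagonal.mp hp ▸ Nat.le_add_left _ _)]

theorem act_mul (f g : (Module.End k A)⟦X⟧) (a : A⟦X⟧) :
    act (f * g) a = act f (act g a) := by
  ext i
  simp only [coeff_act, coeff_mul, LinearMap.sum_apply, map_sum, Module.End.mul_apply, sum_sigma']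
  refine sum_nbij' (fun s => ⟨(s.2.1, s.2.2 + s.1.2), (s.2.2, s.1.2)⟩)
    (fun s => ⟨(s.1.1 + s.2.1, s.2.2), (s.1.1, s.2.1)⟩) ?_ ?_ ?_ ?_ ?_
  · rintro ⟨⟨_, _⟩, ⟨_, _⟩⟩ h
    simp only [mem_sigma, HasAntidiagonal.mem_antidiagonal] at h ⊢
    lia
  · rintro ⟨⟨_, _⟩, ⟨_, _⟩⟩ h
    simp only [mem_sigma, HasAntidiagonal.mem_antidiagonal] at h ⊢
    lia
  · rintro ⟨⟨_, _⟩, ⟨_, _⟩⟩ h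
    simp only [mem_sigma, HasAntidiagonal.mem_antidiagonal] at h ⊢
    obtain ⟨rfl, rfl⟩ := h
    rfl
  · rintro ⟨⟨_, _⟩, ⟨_, _⟩⟩ h
    simp only [mem_sigma, HasAntidiagonal.mem_antidiagonal] at h ⊢
    obtain ⟨rfl, rfl⟩ := h
    rfl
  · rintro ⟨⟨_, _⟩, ⟨_, _⟩⟩ _
    rfl

theorem one_act (a : A⟦X⟧) : act (1 : (Module.End k A)⟦X⟧) a = a := by
  ext i
  rw [coeff_act, sum_eq_single (0, i)]
  · simp
  · rintro ⟨p, q⟩ hp hne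
    have hp0 : p ≠ 0 := by
      rintro rfl
      simp_all
    simp [coeff_one, hp0]
  · simp

theorem coeff_act_C (f : (Module.End k A)⟦X⟧) (x : A) (i : ℕ) :
    coeff i (act f (C x)) = coeff i f x := by
  rw [coeff_act, sum_eq_single (i, 0)]
  · simp
  · rintro ⟨p, q⟩ hp hne
    have hq0 : q ≠ 0 := by
      rintro rfl
      simp_all
    simp [coeff_C, hq0]
  · simp

/-- A power series of endomorphisms of `A` that is multiplicative modulo `X ^ n`. -/
def IsMultiplicative (n : ℕ) (f : (Module.End k A)⟦X⟧) : Prop :=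
  ∀ i < n, ∀ x y : A,
    coeff i f (x * y) = ∑ p ∈ antidiagonal i, coeff p.1 f x * coeff p.2 f y

theorem IsMultiplicative.coeff_act_mul {n : ℕ} {f : (Module.End k A)⟦X⟧}
    (hf : IsMultiplicative n f) (a b : A⟦X⟧) {i : ℕ} (hi : i < n) :
    coeff i (act f (a * b)) = coeff i (act f a * act f b) := by
  have hl : coeff i (act f (a * b)) = ∑ p ∈ antidiagonal i, ∑ r ∈ antidiagonal p.2,
      ∑ q ∈ antidiagonal p.1, coeff q.1 f (coeff r.1 a) * coeff q.2 f (coeff r.2 b) := by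
    rw [coeff_act]
    refine sum_congr rfl fun p hp => ?_
    have hp' := HasAntidiagonal.mem_antidiagonal.mp hp
    rw [coeff_mul, map_sum]
    exact sum_congr rfl fun r _ => hf _ (by lia) _ _
  rw [hl]
  simp only [coeff_mul, coeff_act, sum_mul_sum, sum_sigma']
  refine sum_nbij'
    (fun s => ⟨(s.2.2.1 + s.2.1.1, s.2.2.2 + s.2.1.2), (s.2.2.1, s.2.1.1), (s.2.2.2, s.2.1.2)⟩)
    (fun s => ⟨(s.2.1.1 + s.2.2.1, s.2.1.2 + s.2.2.2), (s.2.1.2, s.2.2.2), (s.2.1.1, s.2.2.1)⟩)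
    ?_ ?_ ?_ ?_ ?_
  · rintro ⟨⟨_, _⟩, ⟨_, _⟩, ⟨_, _⟩⟩ h
    simp only [mem_sigma, HasAntidiagonal.mem_antidiagonal] at h ⊢
    lia
  · rintro ⟨⟨_, _⟩, ⟨_, _⟩, ⟨_, _⟩⟩ h
    simp only [mem_sigma, HasAntidiagonal.mem_antidiagonal] at h ⊢
    lia
  · rintro ⟨⟨_, _⟩, ⟨_, _⟩, ⟨_, _⟩⟩ h
    simp only [mem_sigma, HasAntidiagonal.mem_antidiagonal] at h ⊢
    obtain ⟨rfl, rfl, rfl⟩ := h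
    rfl
  · rintro ⟨⟨_, _⟩, ⟨_, _⟩, ⟨_, _⟩⟩ h
    simp only [mem_sigma, HasAntidiagonal.mem_antidiagonal] at h ⊢
    obtain ⟨rfl, rfl, rfl⟩ := h
    rfl
  · rintro ⟨⟨_, _⟩, ⟨_, _⟩, ⟨_, _⟩⟩ _
    rfl

theorem isMultiplicative_of_coeff_act {n : ℕ} {f : (Module.End k A)⟦X⟧}
    (h : ∀ i < n, ∀ x y : A,
      coeff i (act f (C (x * y))) = coeff i (act f (C x) * act f (C y))) :
    IsMultiplicative n f := by
  intro i hi x y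
  simpa only [coeff_mul, coeff_act_C] using h i hi x y

theorem IsMultiplicative.mul {n : ℕ} {f g : (Module.End k A)⟦X⟧}
    (hf : IsMultiplicative n f) (hg : IsMultiplicative n g) : IsMultiplicative n (f * g) := by
  refine isMultiplicative_of_coeff_act fun i hi x y => ?_
  rw [act_mul, act_mul, act_mul, ← hf.coeff_act_mul _ _ hi]
  refine coeff_act_congr f fun j hj => ?_
  rw [map_mul, hg.coeff_act_mul _ _ (hj.trans_lt hi)]

theorem IsMultiplicative.of_mul_eq_one {n : ℕ} {f g : (Module.End k A)⟦X⟧}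
    (hf : IsMultiplicative n f) (hfg : f * g = 1) (hgf : g * f = 1) :
    IsMultiplicative n g := by
  refine isMultiplicative_of_coeff_act fun i hi x y => ?_
  rw [← one_act (k := k) (act g (C x) * act g (C y)), ← hgf, act_mul]
  refine coeff_act_congr g fun j hj => ?_
  rw [hf.coeff_act_mul _ _ (hj.trans_lt hi), ← act_mul, ← act_mul, hfg, one_act, one_act, map_mul]

theorem isMultiplicative_one (n : ℕ) : IsMultiplicative n (1 : (Module.End k A)⟦X⟧) :=
  isMultiplicative_of_coeff_act fun i _ x y => by simp only [one_act, map_mul]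

theorem isFinIntegrable_iff {m n : ℕ} (hm : 1 ≤ m) (D : A →ₗ[k] A) :
    IsFinIntegrable k A m n D ↔ ∃ F : (Module.End k A)⟦X⟧,
      constantCoeff F = D ∧ IsMultiplicative n (1 + X ^ m * F) := by
  constructor
  · rintro ⟨α, h0, hlt, hD, hmul⟩
    refine ⟨PowerSeries.mk fun i => α (i + m), by simpa using hD, ?_⟩
    have hα : ∀ i, coeff i (1 + X ^ m * PowerSeries.mk fun i => α (i + m)) = α i := by
      intro i
      rw [map_add, coeff_one, coeff_X_pow_mul']
      rcases Nat.eq_zero_or_pos i with rfl | hi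
      · simp [h0, Nat.pos_iff_ne_zero.mp hm, Module.End.one_eq_id]
      · by_cases him : m ≤ i
        · simp [hi.ne', him]
        · simp [hi.ne', him, hlt i hi (not_le.mp him)]
    intro i hi x y
    simp only [hα, Nat.sum_antidiagonal_eq_sum_range_succ_mk, hmul i hi]
  · rintro ⟨F, hF, hmul⟩
    refine ⟨fun i => coeff i (1 + X ^ m * F), ?_, ?_, ?_, ?_⟩
    · simp [Nat.pos_iff_ne_zero.mp hm, Module.End.one_eq_id]
    · intro i hi him
      simp [coeff_one, coeff_X_pow_mul', hi.ne', not_le.mpr him]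
    · simp [coeff_one, coeff_X_pow_mul', Nat.pos_iff_ne_zero.mp hm, hF]
    · intro i hi x y
      rw [hmul i hi, Nat.sum_antidiagonal_eq_sum_range_succ_mk]

theorem isFinIntegrable_zero {m n : ℕ} (hm : 1 ≤ m) :
    IsFinIntegrable k A m n (0 : A →ₗ[k] A) :=
  (isFinIntegrable_iff hm _).mpr ⟨0, by simp, by simpa using isMultiplicative_one n⟩

theorem isFinIntegrable_add {m n : ℕ} (hm : 1 ≤ m) {D E : A →ₗ[k] A}
    (hD : IsFinIntegrable k A m n D) (hE : IsFinIntegrable k A m n E) :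
    IsFinIntegrable k A m n (D + E) := by
  rw [isFinIntegrable_iff hm] at hD hE ⊢
  obtain ⟨F, rfl, hF⟩ := hD
  obtain ⟨G, rfl, hG⟩ := hE
  refine ⟨F + G + F * (X ^ m * G), ?_, ?_⟩
  · simp [Nat.pos_iff_ne_zero.mp hm]
  · convert hF.mul hG using 1
    noncomm_ring

theorem isFinIntegrable_neg {m n : ℕ} (hm : 1 ≤ m) {D : A →ₗ[k] A}
    (hD : IsFinIntegrable k A m n D) : IsFinIntegrable k A m n (-D) := by
  rw [isFinIntegrable_iff hm] at hD ⊢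
  obtain ⟨F, rfl, hF⟩ := hD
  have hc : constantCoeff (1 + X ^ m * F) = ((1 : (Module.End k A)ˣ) : Module.End k A) := by
    simp [Nat.pos_iff_ne_zero.mp hm]
  have hfg := mul_invOfUnit _ _ hc
  have hgf := invOfUnit_mul _ _ hc
  have hg0 := constantCoeff_invOfUnit (1 + X ^ m * F) 1
  set g := invOfUnit (1 + X ^ m * F) 1
  refine ⟨-(F * g), by simp [hg0], ?_⟩
  convert hF.of_mul_eq_one hfg hgf using 1
  rw [add_mul, one_mul, ← eq_sub_iff_add_eq] at hfg
  rw [sub_eq_add_neg, mul_assoc] at hfg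
  exact (congrArg (1 + ·) (mul_neg (X ^ m) (F * g))).trans hfg.symm

/-- The integers `c` such that `c • D` is `[m,n)`-integrable. -/
def integrableMultiples {m : ℕ} (n : ℕ) (hm : 1 ≤ m) (D : A →ₗ[k] A) : Ideal ℤ where
  carrier := {c | IsFinIntegrable k A m n (c • D)}
  zero_mem' := by simpa using isFinIntegrable_zero hm
  add_mem' {a b} ha hb := by
    simpa only [Set.mem_ofPred_eq, add_smul] using isFinIntegrable_add hm ha hb
  smul_mem' c x hx := by
    simp only [Set.mem_ofPred_eq, smul_eq_mul, mul_smul] at hx ⊢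
    induction c with
    | zero => simpa using isFinIntegrable_zero hm
    | succ c ih => simpa only [add_smul, one_smul] using isFinIntegrable_add hm ih hx
    | pred c ih =>
      rw [sub_smul, one_smul, sub_eq_add_neg]
      exact isFinIntegrable_add hm ih (isFinIntegrable_neg hm hx)

end Series

section BaseChange

variable {k A : Type*} [CommRing k] [Ring A] [Algebra k A]

theorem isFinIntegrable_baseChange (K : Type*) [CommRing K] [Algebra k K] {m n : ℕ}
    {D : A →ₗ[k] A} (hD : IsFinIntegrable k A m n D) :
    IsFinIntegrable K (K ⊗[k] A) m n (D.baseChange K) := by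
  obtain ⟨α, h0, hlt, rfl, hmul⟩ := hD
  refine ⟨fun i => (α i).baseChange K, by simp [h0], fun i h1 h2 => by simp [hlt i h1 h2], rfl, ?_⟩
  intro i hi x y
  induction x with
  | zero => simp
  | add x x' hx hx' => simp only [add_mul, map_add, hx, hx', sum_add_distrib]
  | tmul a x =>
    induction y with
    | zero => simp
    | add y y' hy hy' => simp only [mul_add, map_add, hy, hy', sum_add_distrib]
    | tmul b y => simp [hmul i hi, TensorProduct.tmul_sum]

theorem exists_smul_isFinIntegrable_of_baseChange [IsNoetherianRing k] [Module.Finite k A]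
    (S : Submonoid k) (K : Type*) [CommRing K] [Algebra k K] [IsLocalization S K] {m n : ℕ}
    (hm : 1 ≤ m) (hmn : m < n) {D : A →ₗ[k] A}
    (hD : IsFinIntegrable K (K ⊗[k] A) m n (D.baseChange K)) :
    ∃ s ∈ S, IsFinIntegrable k A m n (s • D) := by
  have : Module.FinitePresentation k A := Module.finitePresentation_of_finite k A
  obtain ⟨α, h0, hlt, hαm, hmul⟩ := hD
  let ι : A →ₗ[k] K ⊗[k] A := TensorProduct.mk k K A 1
  have hι : ∀ x y, ι (x * y) = ι x * ι y := fun x y => by simp [ι]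
  have hlift : ∀ i, ∃ (h : A →ₗ[k] A) (s : S), ι ∘ₗ h = s • ((α i).restrictScalars k ∘ₗ ι) :=
    fun i => Module.FinitePresentation.exists_lift_of_isLocalizedModule S ι _
  choose g s hg using hlift
  let σ : S := ∏ i ∈ range n, s i
  obtain ⟨γ, hγ0, hγlt, hγm, hγ⟩ : ∃ γ : ℕ → (A →ₗ[k] A), γ 0 = LinearMap.id ∧
      (∀ i, 0 < i → i < m → γ i = 0) ∧ γ m = (σ : k) ^ m • D ∧
      ∀ i < n, ∀ x, ι (γ i x) = (σ : k) ^ i • α i (ι x) := by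
    refine ⟨fun i => if i = 0 then LinearMap.id else if i < m then 0 else if i = m then
      (σ : k) ^ m • D else ((σ : k) ^ (i - 1) * ∏ j ∈ (range n).erase i, (s j : k)) • g i,
      by simp, fun i h1 h2 => by simp [h1.ne', h2], by simp [Nat.pos_iff_ne_zero.mp hm],
      fun i hi x => ?_⟩
    dsimp only
    split_ifs with h1 h2 h3
    · subst h1
      simp [h0]
    · simp [hlt i (Nat.pos_of_ne_zero h1) h2]
    · subst h3
      simp [hαm, ι]
    · have hgx : ι (g i x) = (s i : k) • α i (ι x) := LinearMap.congr_fun (hg i) x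
      have hσ : (σ : k) = (∏ j ∈ (range n).erase i, (s j : k)) * s i := by
        rw [prod_erase_mul _ _ (mem_range.mpr hi)]
        simp [σ]
      rw [LinearMap.smul_apply, map_smul, hgx, smul_smul, mul_assoc, ← hσ, ← pow_succ,
        Nat.sub_add_cancel (Nat.pos_of_ne_zero h1)]
  have hdefect : ∀ i, ∃ u : S, i < n → ∀ x y, (u : k) • γ i (x * y) =
      (u : k) • ∑ j ∈ range (i + 1), γ j x * γ (i - j) y := by
    intro i
    by_cases hi : i < n
    · obtain ⟨u, hu⟩ := Module.Finite.exists_smul_of_comp_eq_of_isLocalizedModule S ι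
        (γ i ∘ₗ LinearMap.mul' k A)
        (∑ j ∈ range (i + 1), LinearMap.mul' k A ∘ₗ TensorProduct.map (γ j) (γ (i - j))) (by
          refine TensorProduct.ext' fun x y => ?_
          simp only [LinearMap.comp_apply, LinearMap.mul'_apply, LinearMap.sum_apply,
            TensorProduct.map_tmul, map_sum, hι]
          rw [hγ i hi, hι, hmul i hi, smul_sum]
          refine sum_congr rfl fun j hj => ?_
          have hj' := mem_range.mp hj
          rw [hγ j (by lia), hγ (i - j) (by lia), smul_mul_smul_comm, ← pow_add,
            Nat.add_sub_cancel' (by lia)])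
      refine ⟨u, fun _ x y => ?_⟩
      simpa [Submonoid.smul_def] using LinearMap.congr_fun hu (x ⊗ₜ y)
    · exact ⟨1, fun h => absurd h hi⟩
  choose u hu using hdefect
  let υ : S := ∏ i ∈ range n, u i
  refine ⟨(υ : k) ^ m * (σ : k) ^ m, mul_mem (pow_mem υ.2 _) (pow_mem σ.2 _),
    fun i => (υ : k) ^ i • γ i, by simp [hγ0], fun i h1 h2 => by simp [hγlt i h1 h2],
    by simp [hγm, smul_smul], fun i hi x y => ?_⟩
  have hsum : ∑ j ∈ range (i + 1), ((υ : k) ^ j • γ j) x * ((υ : k) ^ (i - j) • γ (i - j)) y =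
      (υ : k) ^ i • ∑ j ∈ range (i + 1), γ j x * γ (i - j) y := by
    rw [smul_sum]
    refine sum_congr rfl fun j hj => ?_
    have hj' := mem_range.mp hj
    rw [LinearMap.smul_apply, LinearMap.smul_apply, smul_mul_smul_comm, ← pow_add,
      Nat.add_sub_cancel' (by lia)]
  rw [hsum, LinearMap.smul_apply]
  rcases Nat.eq_zero_or_pos i with rfl | hpos
  · simp [hγ0]
  · obtain ⟨c, hc⟩ : (u i : k) ∣ (υ : k) ^ i := by
      refine dvd_pow ?_ hpos.ne'
      simpa [υ] using dvd_prod_of_mem (fun j => (u j : k)) (mem_range.mpr hi)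
    rw [hc, mul_comm, mul_smul, mul_smul, hu i hi]

end BaseChange

end HasseSchmidt

/-- A derivation on a Noether algebra `A` is `[m,n)`-integrable iff for every
prime `p` the induced `k_p`-linear derivation `D ⊗ id` on
`A_p = A ⊗_ℤ ℤ_(p)` (realised here as `k_p ⊗_k A`, where `k_p = k ⊗_ℤ ℤ_(p)`)
is `[m,n)`-integrable. -/
theorem statement5 (k : Type*) [CommRing k] [IsNoetherianRing k]
    (A : Type*) [Ring A] [Algebra k A] [Module.Finite k A]
    (m n : ℕ) (hm : 1 ≤ m) (hmn : m < n)
    (D : A →ₗ[k] A) (hD : IsDerivation k A D) :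
    IsFinIntegrable k A m n D ↔
      ∀ (p : ℕ) (hp : p.Prime),
        IsFinIntegrable (Kp k p hp) (Kp k p hp ⊗[k] A) m n
          (LinearMap.baseChange (Kp k p hp) D) := by
  refine ⟨fun h p hp => HasseSchmidt.isFinIntegrable_baseChange (Kp k p hp) h, fun h => ?_⟩
  suffices htop : HasseSchmidt.integrableMultiples n hm D = ⊤ by
    have hone : (1 : ℤ) ∈ HasseSchmidt.integrableMultiples n hm D := htop ▸ Submodule.mem_top
    have hint : IsFinIntegrable k A m n ((1 : ℤ) • D) := hone
    rwa [one_smul] at hint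
  by_contra hne
  obtain ⟨p, hp, hle⟩ : ∃ p : ℕ, p.Prime ∧
      HasseSchmidt.integrableMultiples n hm D ≤ Ideal.span {(p : ℤ)} := by
    obtain ⟨g, hg⟩ := (inferInstance : (HasseSchmidt.integrableMultiples n hm D).IsPrincipal)
    have hg' : HasseSchmidt.integrableMultiples n hm D = Ideal.span {g} := hg
    have hunit : g.natAbs ≠ 1 := by
      intro h1
      exact hne (hg'.trans (Ideal.span_singleton_eq_top.mpr (Int.isUnit_iff_natAbs_eq.mpr h1)))
    obtain ⟨p, hp, hpg⟩ := Nat.exists_prime_and_dvd hunit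
    refine ⟨p, hp, ?_⟩
    rw [hg', Ideal.span_singleton_le_span_singleton]
    exact Int.natCast_dvd.mpr hpg
  have := intSpanPrime p hp
  have : IsLocalization (Algebra.algebraMapSubmonoid k (Ideal.span {(p : ℤ)}).primeCompl)
      (Kp k p hp) := inferInstance
  obtain ⟨_, ⟨z, hz, rfl⟩, hs⟩ := HasseSchmidt.exists_smul_isFinIntegrable_of_baseChange
    (Algebra.algebraMapSubmonoid k (Ideal.span {(p : ℤ)}).primeCompl) (Kp k p hp) hm hmn (h p hp)
  refine hz (hle ?_)
  change IsFinIntegrable k A m n (z • D)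
  have hz : z • D = algebraMap ℤ k z • D := by
    ext x
    simp [Int.cast_smul_eq_zsmul]
  rwa [hz]
end

section
/- Let k be a commutative Artinian ring and A an associative unital k-algebra that is finitely generated as a k-module (an Artin algebra), and let m ≥ 1. A k-derivation D on A is [m,n)-integrable for every n > m if and only if D is [m,∞]-integrable. -/
namespace HasseSchmidt

open MvPowerSeries Finset

variable {k A : Type*} [CommRing k] [Ring A] [Algebra k A] {σ : Type*}

/-- The failure at index `ν` of a series of linear endomorphisms to be multiplicative. -/
noncomputable def defect (α : MvPowerSeries σ (Module.End k A)) (ν : σ →₀ ℕ) : A → A → A := by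
  classical exact fun x y => coeff ν α (x * y) - ∑ p ∈ antidiagonal ν, coeff p.1 α x * coeff p.2 α y

theorem defect_apply [DecidableEq σ] (α : MvPowerSeries σ (Module.End k A)) (ν : σ →₀ ℕ) (x y : A) :
    defect α ν x y =
      coeff ν α (x * y) - ∑ p ∈ antidiagonal ν, coeff p.1 α x * coeff p.2 α y := by
  rw [defect]
  congr!

theorem sum_antidiagonal_antidiagonal_swap {M N : Type*} [AddCommMonoid M] [HasAntidiagonal M]
    [AddCommMonoid N] (F : M → M → M → M → N) (ν : M) :
    ∑ w ∈ antidiagonal ν, ∑ a ∈ antidiagonal w.1, ∑ b ∈ antidiagonal w.2,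
        F a.1 a.2 b.1 b.2 =
      ∑ w ∈ antidiagonal ν, ∑ a ∈ antidiagonal w.1, ∑ b ∈ antidiagonal w.2,
        F a.1 b.1 a.2 b.2 := by
  simp only [← sum_product', sum_sigma']
  refine sum_nbij'
    (fun w => ⟨(w.2.1.1 + w.2.2.1, w.2.1.2 + w.2.2.2),
      ((w.2.1.1, w.2.2.1), (w.2.1.2, w.2.2.2))⟩)
    (fun w => ⟨(w.2.1.1 + w.2.2.1, w.2.1.2 + w.2.2.2),
      ((w.2.1.1, w.2.2.1), (w.2.1.2, w.2.2.2))⟩) ?_ ?_ ?_ ?_ ?_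
  · rintro ⟨⟨u, v⟩, ⟨a, b⟩, ⟨c, d⟩⟩ h
    simp only [mem_sigma, HasAntidiagonal.mem_antidiagonal, mem_product, and_true] at h ⊢
    rw [add_add_add_comm, h.2.1, h.2.2, h.1]
  · rintro ⟨⟨u, v⟩, ⟨a, b⟩, ⟨c, d⟩⟩ h
    simp only [mem_sigma, HasAntidiagonal.mem_antidiagonal, mem_product, and_true] at h ⊢
    rw [add_add_add_comm, h.2.1, h.2.2, h.1]
  · rintro ⟨⟨u, v⟩, ⟨a, b⟩, ⟨c, d⟩⟩ h
    simp only [mem_sigma, HasAntidiagonal.mem_antidiagonal, mem_product] at h ⊢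
    rw [h.2.1, h.2.2]
  · rintro ⟨⟨u, v⟩, ⟨a, b⟩, ⟨c, d⟩⟩ h
    simp only [mem_sigma, HasAntidiagonal.mem_antidiagonal, mem_product] at h ⊢
    rw [h.2.1, h.2.2]
  · rintro ⟨⟨u, v⟩, ⟨a, b⟩, ⟨c, d⟩⟩ h
    rfl

theorem defect_mul_apply [DecidableEq σ] (α β : MvPowerSeries σ (Module.End k A)) (ν : σ →₀ ℕ)
    (x y : A) :
    defect (α * β) ν x y =
      ∑ p ∈ antidiagonal ν, coeff p.1 α (defect β p.2 x y) +
      ∑ p ∈ antidiagonal ν, ∑ q ∈ antidiagonal p.2,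
        defect α p.1 (coeff q.1 β x) (coeff q.2 β y) := by
  have h := sum_antidiagonal_antidiagonal_swap
    (fun a b c d => coeff a α (coeff c β x) * coeff b α (coeff d β y)) ν
  simp only [defect_apply, map_sub, sum_sub_distrib, coeff_mul, LinearMap.sum_apply,
    Module.End.mul_apply, sum_mul_sum, map_sum]
  rw [← h, sub_add_sub_comm, add_comm]
  have h2 : ∀ p : (σ →₀ ℕ) × (σ →₀ ℕ),
      ∑ q ∈ antidiagonal p.2, ∑ r ∈ antidiagonal p.1,
        coeff r.1 α (coeff q.1 β x) * coeff r.2 α (coeff q.2 β y) =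
      ∑ r ∈ antidiagonal p.1, ∑ q ∈ antidiagonal p.2,
        coeff r.1 α (coeff q.1 β x) * coeff r.2 α (coeff q.2 β y) := fun p => sum_comm
  simp only [h2]
  abel

theorem defect_zero {α : MvPowerSeries σ (Module.End k A)} (h : coeff 0 α = 1) :
    defect α 0 = 0 := by
  classical
  ext x y
  simp [defect_apply, h, -coeff_zero_eq_constantCoeff]

theorem defect_one (ν : σ →₀ ℕ) : defect (1 : MvPowerSeries σ (Module.End k A)) ν = 0 := by
  classical
  by_cases hν : ν = 0
  · subst hν
    exact defect_zero (by simp)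
  ext x y
  rw [defect_apply, coeff_one, if_neg hν, sum_eq_zero]
  · simp
  · rintro ⟨a, b⟩ h
    rw [HasAntidiagonal.mem_antidiagonal] at h
    by_cases ha : a = 0
    · have : b ≠ 0 := by rintro rfl; exact hν (by rw [← h, ha, add_zero])
      simp [coeff_one, this]
    · simp [coeff_one, ha]

theorem degree_lt_of_mem_antidiagonal [DecidableEq σ] {ν : σ →₀ ℕ} {p : (σ →₀ ℕ) × (σ →₀ ℕ)}
    (h : p ∈ antidiagonal ν) (h0 : p.2 ≠ 0) : p.1.degree < ν.degree := by
  rw [HasAntidiagonal.mem_antidiagonal] at h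
  rw [← h, map_add]
  have := (Finsupp.degree_eq_zero_iff p.2).not.2 h0
  omega

theorem degree_lt_of_mem_antidiagonal' [DecidableEq σ] {ν : σ →₀ ℕ} {p : (σ →₀ ℕ) × (σ →₀ ℕ)}
    (h : p ∈ antidiagonal ν) (h0 : p.1 ≠ 0) : p.2.degree < ν.degree := by
  rw [HasAntidiagonal.mem_antidiagonal] at h
  rw [← h, map_add]
  have := (Finsupp.degree_eq_zero_iff p.1).not.2 h0
  omega

theorem defect_mul {α β : MvPowerSeries σ (Module.End k A)} (hα : coeff 0 α = 1)
    (hβ : coeff 0 β = 1) {ν : σ →₀ ℕ} (h1 : ∀ i : σ →₀ ℕ, i.degree < ν.degree → defect α i = 0)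
    (h2 : ∀ i : σ →₀ ℕ, i.degree < ν.degree → defect β i = 0) :
    defect (α * β) ν = defect α ν + defect β ν := by
  classical
  ext x y
  rw [defect_mul_apply, sum_eq_single (0, ν), sum_eq_single (ν, 0)]
  · simp [hα, hβ, add_comm, -coeff_zero_eq_constantCoeff]
  · rintro ⟨a, b⟩ h hne
    refine sum_eq_zero fun q _ => ?_
    rw [h1 _ (degree_lt_of_mem_antidiagonal h _)]
    · rfl
    · rintro rfl
      simp_all
  · simp
  · rintro ⟨a, b⟩ h hne
    rw [h2 _ (degree_lt_of_mem_antidiagonal' h _)]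
    · simp
    · rintro rfl
      simp_all
  · simp

/-- Series with constant term `1` that are multiplicative in total degrees below `n`. -/
def IsHS (n : ℕ) (α : MvPowerSeries σ (Module.End k A)) : Prop :=
  coeff 0 α = 1 ∧ ∀ ν : σ →₀ ℕ, ν.degree < n → defect α ν = 0

/-- The coefficients in positive total degrees below `m` vanish. -/
def StartsAt (m : ℕ) (α : MvPowerSeries σ (Module.End k A)) : Prop :=
  ∀ ν : σ →₀ ℕ, ν ≠ 0 → ν.degree < m → coeff ν α = 0

theorem StartsAt.one (α : MvPowerSeries σ (Module.End k A)) : StartsAt 1 α := fun ν hν h =>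
  absurd ((Finsupp.degree_eq_zero_iff ν).1 (by omega)) hν

theorem IsHS.mono {m n : ℕ} (h : m ≤ n) {α : MvPowerSeries σ (Module.End k A)} (hα : IsHS n α) :
    IsHS m α := ⟨hα.1, fun ν hν => hα.2 ν (by omega)⟩

theorem isHS_one (n : ℕ) : IsHS n (1 : MvPowerSeries σ (Module.End k A)) :=
  ⟨by simp, fun ν _ => defect_one ν⟩

theorem IsHS.defect_mul {n : ℕ} {α β : MvPowerSeries σ (Module.End k A)} (hα : IsHS n α)
    (hβ : IsHS n β) {ν : σ →₀ ℕ} (hν : ν.degree ≤ n) :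
    defect (α * β) ν = defect α ν + defect β ν :=
  HasseSchmidt.defect_mul hα.1 hβ.1 (fun i hi => hα.2 i (by omega)) fun i hi => hβ.2 i (by omega)

theorem IsHS.mul {n : ℕ} {α β : MvPowerSeries σ (Module.End k A)} (hα : IsHS n α)
    (hβ : IsHS n β) : IsHS n (α * β) := by
  classical
  refine ⟨?_, fun ν hν => ?_⟩
  · rw [coeff_mul]
    simp [hα.1, hβ.1, -coeff_zero_eq_constantCoeff]
  · rw [hα.defect_mul hβ hν.le, hα.2 ν hν, hβ.2 ν hν, add_zero]

theorem StartsAt.coeff_mul {m : ℕ} {α β : MvPowerSeries σ (Module.End k A)} (hα0 : coeff 0 α = 1)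
    (hβ0 : coeff 0 β = 1) (hα : StartsAt m α) {ν : σ →₀ ℕ} (hν0 : ν ≠ 0) (hν : ν.degree ≤ m) :
    coeff ν (α * β) = coeff ν α + coeff ν β := by
  classical
  rw [MvPowerSeries.coeff_mul, ← sum_subset (s₁ := {(ν, 0), (0, ν)})]
  · rw [sum_pair (by simp [hν0])]
    simp [hα0, hβ0, -coeff_zero_eq_constantCoeff]
  · intro p
    simp only [mem_insert, mem_singleton, HasAntidiagonal.mem_antidiagonal]
    rintro (rfl | rfl) <;> simp
  · rintro ⟨a, b⟩ h hne
    have ha : a ≠ 0 := by rintro rfl; simp_all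
    have hb : b ≠ 0 := by rintro rfl; simp_all
    rw [hα a ha (lt_of_lt_of_le (degree_lt_of_mem_antidiagonal h hb) hν), zero_mul]

theorem StartsAt.mul {m : ℕ} {α β : MvPowerSeries σ (Module.End k A)} (hα0 : coeff 0 α = 1)
    (hβ0 : coeff 0 β = 1) (hα : StartsAt m α) (hβ : StartsAt m β) : StartsAt m (α * β) :=
  fun ν h0 h => by rw [hα.coeff_mul hα0 hβ0 h0 h.le, hα ν h0 h, hβ ν h0 h, add_zero]

theorem IsHS.exists_inv {n : ℕ} {α : MvPowerSeries σ (Module.End k A)} (hα : IsHS n α) :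
    ∃ β, α * β = 1 ∧ IsHS n β ∧ (∀ ν : σ →₀ ℕ, ν.degree ≤ n → defect β ν = -defect α ν) ∧
      ∀ m, StartsAt m α → ∀ ν : σ →₀ ℕ, ν ≠ 0 → ν.degree ≤ m → coeff ν β = -coeff ν α := by
  classical
  have hmul := mul_invOfUnit α 1 (by simpa using hα.1)
  have hβ0 : coeff 0 (invOfUnit α 1) = 1 := by simp
  have key : ∀ d, d ≤ n → ∀ ν : σ →₀ ℕ, ν.degree = d →
      defect (invOfUnit α 1) ν = -defect α ν := by
    intro d
    induction d using Nat.strong_induction_on with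
    | _ d ih =>
      rintro hd ν rfl
      have := HasseSchmidt.defect_mul hα.1 hβ0 (ν := ν) (fun i hi => hα.2 i (by omega))
        (fun i hi => by rw [ih _ hi (by omega) i rfl, hα.2 i (by omega), neg_zero])
      rw [hmul, defect_one] at this
      exact eq_neg_of_add_eq_zero_right this.symm
  refine ⟨invOfUnit α 1, hmul, ⟨hβ0, fun ν hν => ?_⟩, fun ν hν => key _ hν ν rfl,
    fun m hm ν h0 h => ?_⟩
  · rw [key _ hν.le ν rfl, hα.2 ν hν, neg_zero]
  · have := hm.coeff_mul hα.1 hβ0 h0 h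
    rw [hmul, coeff_one, if_neg h0] at this
    exact eq_neg_of_add_eq_zero_right this.symm

theorem sum_range_product_eq_sum_antidiagonal {M : Type*} [AddCommMonoid M] (N : ℕ)
    (f : ℕ × ℕ → M) (hf : ∀ p : ℕ × ℕ, N < p.1 + p.2 → f p = 0) :
    ∑ p ∈ range (N + 1) ×ˢ range (N + 1), f p =
      ∑ e ∈ range (N + 1), ∑ p ∈ antidiagonal e, f p := by
  rw [sum_sigma', ← sum_filter_of_ne (p := fun p : ℕ × ℕ => p.1 + p.2 ≤ N)]
  · refine sum_nbij' (fun p => ⟨p.1 + p.2, p⟩) (fun q => q.2) ?_ ?_ ?_ ?_ ?_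
    · rintro ⟨a, b⟩ h
      simp at h ⊢
      omega
    · rintro ⟨e, a, b⟩ h
      simp at h ⊢
      omega
    · intros; rfl
    · rintro ⟨e, a, b⟩ h
      simp only [mem_sigma, HasAntidiagonal.mem_antidiagonal] at h
      simp [h.2]
    · intros; rfl
  · intro p _ hp
    by_contra h
    exact hp (hf p (by omega))

/-- Substitution of a series `u` without constant term into a one-variable series. -/
noncomputable def substSeries (u : MvPowerSeries σ k) (β : PowerSeries (Module.End k A)) :
    MvPowerSeries σ (Module.End k A) :=
  fun ν => ∑ c ∈ range (ν.degree + 1), coeff ν (u ^ c) • PowerSeries.coeff c β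

theorem coeff_pow_eq_zero {u : MvPowerSeries σ k} (hu : constantCoeff u = 0) {c : ℕ}
    {ν : σ →₀ ℕ} (h : ν.degree < c) : coeff ν (u ^ c) = 0 :=
  coeff_of_lt_order (lt_of_lt_of_le (by exact_mod_cast h)
    (le_order_pow_of_constantCoeff_eq_zero c hu))

theorem coeff_substSeries {u : MvPowerSeries σ k} (hu : constantCoeff u = 0)
    (β : PowerSeries (Module.End k A)) {ν : σ →₀ ℕ} {N : ℕ} (hN : ν.degree ≤ N) :
    coeff ν (substSeries u β) =
      ∑ c ∈ range (N + 1), coeff ν (u ^ c) • PowerSeries.coeff c β := by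
  refine sum_subset (range_subset_range.2 (by omega)) fun c _ hc => ?_
  rw [coeff_pow_eq_zero hu (by simpa using hc), zero_smul]

theorem defect_single_apply (β : PowerSeries (Module.End k A)) (c : ℕ) (x y : A) :
    defect β (Finsupp.single () c) x y = PowerSeries.coeff c β (x * y) -
      ∑ p ∈ antidiagonal c, PowerSeries.coeff p.1 β x * PowerSeries.coeff p.2 β y := by
  rw [defect_apply, Finsupp.antidiagonal_single, sum_map]
  rfl

theorem defect_substSeries {u : MvPowerSeries σ k} (hu : constantCoeff u = 0)
    (β : PowerSeries (Module.End k A)) (ν : σ →₀ ℕ) :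
    defect (substSeries u β) ν =
      ∑ c ∈ range (ν.degree + 1), coeff ν (u ^ c) • defect β (Finsupp.single () c) := by
  classical
  ext x y
  have hdeg : ∀ p ∈ antidiagonal ν, p.1.degree ≤ ν.degree ∧ p.2.degree ≤ ν.degree := by
    intro p hp
    rw [HasAntidiagonal.mem_antidiagonal] at hp
    rw [← hp, map_add]
    omega
  have h : ∑ p ∈ antidiagonal ν, coeff p.1 (substSeries u β) x * coeff p.2 (substSeries u β) y =
      ∑ c ∈ range (ν.degree + 1), coeff ν (u ^ c) •
        ∑ p ∈ antidiagonal c, PowerSeries.coeff p.1 β x * PowerSeries.coeff p.2 β y := by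
    calc _ = ∑ p ∈ antidiagonal ν, ∑ q ∈ range (ν.degree + 1) ×ˢ range (ν.degree + 1),
          (coeff p.1 (u ^ q.1) * coeff p.2 (u ^ q.2)) •
            (PowerSeries.coeff q.1 β x * PowerSeries.coeff q.2 β y) := by
          refine sum_congr rfl fun p hp => ?_
          rw [coeff_substSeries hu β (hdeg p hp).1, coeff_substSeries hu β (hdeg p hp).2]
          simp only [LinearMap.sum_apply, LinearMap.smul_apply, sum_mul_sum, sum_product,
            smul_mul_smul_comm]
      _ = ∑ q ∈ range (ν.degree + 1) ×ˢ range (ν.degree + 1), coeff ν (u ^ (q.1 + q.2)) •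
            (PowerSeries.coeff q.1 β x * PowerSeries.coeff q.2 β y) := by
          rw [sum_comm]
          refine sum_congr rfl fun q _ => ?_
          rw [← sum_smul, pow_add, coeff_mul]
      _ = _ := by
          rw [sum_range_product_eq_sum_antidiagonal]
          · refine sum_congr rfl fun e _ => ?_
            rw [smul_sum]
            refine sum_congr rfl fun p hp => ?_
            rw [HasAntidiagonal.mem_antidiagonal.1 hp]
          · intro p hp
            rw [coeff_pow_eq_zero hu hp, zero_smul]
  rw [defect_apply, h, coeff_substSeries hu β le_rfl]
  simp only [Finset.sum_apply, Pi.smul_apply, defect_single_apply, smul_sub, sum_sub_distrib,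
    LinearMap.sum_apply, LinearMap.smul_apply]

theorem IsHS.substSeries {u : MvPowerSeries σ k} (hu : constantCoeff u = 0) {n : ℕ}
    {β : PowerSeries (Module.End k A)} (hβ : IsHS n β) : IsHS n (substSeries u β) := by
  refine ⟨?_, fun ν hν => ?_⟩
  · rw [coeff_substSeries hu β (N := 0) (by simp)]
    have : PowerSeries.coeff 0 β = 1 := by
      rw [PowerSeries.coeff, Finsupp.single_zero]
      exact hβ.1
    simp [this, -PowerSeries.coeff_zero_eq_constantCoeff]
  · rw [defect_substSeries hu]
    refine sum_eq_zero fun c hc => ?_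
    rw [mem_range] at hc
    rw [hβ.2 _ (by rw [Finsupp.degree_single]; omega), smul_zero]

theorem nsmul_left_injective_of_ne_zero {μ : σ →₀ ℕ} (hμ : μ ≠ 0) {c d : ℕ}
    (h : c • μ = d • μ) : c = d := by
  have h' := congrArg Finsupp.degree h
  have := (Finsupp.degree_eq_zero_iff μ).not.2 hμ
  simp only [map_nsmul, smul_eq_mul] at h'
  exact Nat.eq_of_mul_eq_mul_right (by omega) h'

theorem constantCoeff_monomial_of_ne_zero {μ : σ →₀ ℕ} (hμ : μ ≠ 0) (a : k) :
    constantCoeff (monomial μ a) = 0 := by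
  classical
  rw [← coeff_zero_eq_constantCoeff_apply, coeff_monomial, if_neg hμ.symm]

theorem le_degree_nsmul {μ : σ →₀ ℕ} (hμ : μ ≠ 0) (c : ℕ) : c ≤ (c • μ).degree := by
  have := (Finsupp.degree_eq_zero_iff μ).not.2 hμ
  rw [map_nsmul, smul_eq_mul]
  exact Nat.le_mul_of_pos_right c (by omega)

theorem coeff_nsmul_substSeries_monomial {μ : σ →₀ ℕ} (hμ : μ ≠ 0) (a : k)
    (β : PowerSeries (Module.End k A)) (c : ℕ) :
    coeff (c • μ) (substSeries (monomial μ a) β) = a ^ c • PowerSeries.coeff c β := by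
  classical
  rw [coeff_substSeries (constantCoeff_monomial_of_ne_zero hμ a) β le_rfl, sum_eq_single c]
  · rw [monomial_pow, coeff_monomial, if_pos rfl]
  · intro d _ hd
    rw [monomial_pow, coeff_monomial,
      if_neg fun h => hd (nsmul_left_injective_of_ne_zero hμ h).symm, zero_smul]
  · intro h
    exact absurd (le_degree_nsmul hμ c) (by simpa using h)

theorem defect_nsmul_substSeries_monomial {μ : σ →₀ ℕ} (hμ : μ ≠ 0) (a : k)
    (β : PowerSeries (Module.End k A)) (c : ℕ) :
    defect (substSeries (monomial μ a) β) (c • μ) = a ^ c • defect β (Finsupp.single () c) := by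
  classical
  rw [defect_substSeries (constantCoeff_monomial_of_ne_zero hμ a) β, sum_eq_single c]
  · rw [monomial_pow, coeff_monomial, if_pos rfl]
  · intro d _ hd
    rw [monomial_pow, coeff_monomial,
      if_neg fun h => hd (nsmul_left_injective_of_ne_zero hμ h).symm, zero_smul]
  · intro h
    exact absurd (le_degree_nsmul hμ c) (by simpa using h)

theorem coeff_substSeries_monomial_of_forall_ne {μ : σ →₀ ℕ} (hμ : μ ≠ 0) (a : k)
    (β : PowerSeries (Module.End k A)) {ν : σ →₀ ℕ} (h : ∀ c : ℕ, ν ≠ c • μ) :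
    coeff ν (substSeries (monomial μ a) β) = 0 := by
  classical
  rw [coeff_substSeries (constantCoeff_monomial_of_ne_zero hμ a) β le_rfl]
  refine sum_eq_zero fun c _ => ?_
  rw [monomial_pow, coeff_monomial, if_neg (h c), zero_smul]

theorem defect_substSeries_monomial_of_forall_ne {μ : σ →₀ ℕ} (hμ : μ ≠ 0) (a : k)
    (β : PowerSeries (Module.End k A)) {ν : σ →₀ ℕ} (h : ∀ c : ℕ, ν ≠ c • μ) :
    defect (substSeries (monomial μ a) β) ν = 0 := by
  classical
  rw [defect_substSeries (constantCoeff_monomial_of_ne_zero hμ a) β]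
  refine sum_eq_zero fun c _ => ?_
  rw [monomial_pow, coeff_monomial, if_neg (h c), zero_smul]

theorem IsHS.substSeries_monomial {μ : σ →₀ ℕ} (hμ : μ ≠ 0) (a : k) {n : ℕ}
    {β : PowerSeries (Module.End k A)} (hβ : IsHS n β) :
    IsHS (μ.degree * n) (HasseSchmidt.substSeries (monomial μ a) β) := by
  refine ⟨(hβ.substSeries (constantCoeff_monomial_of_ne_zero hμ a)).1, fun ν hν => ?_⟩
  by_cases h : ∃ c : ℕ, ν = c • μ
  · obtain ⟨c, rfl⟩ := h
    rw [defect_nsmul_substSeries_monomial hμ, hβ.2, smul_zero]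
    rw [map_nsmul, smul_eq_mul, mul_comm] at hν
    rw [Finsupp.degree_single]
    exact lt_of_mul_lt_mul_left hν (Nat.zero_le _)
  · push Not at h
    exact defect_substSeries_monomial_of_forall_ne hμ a β h

theorem startsAt_substSeries_monomial {μ : σ →₀ ℕ} (hμ : μ ≠ 0) (a : k)
    (β : PowerSeries (Module.End k A)) : StartsAt μ.degree (substSeries (monomial μ a) β) := by
  intro ν h0 hν
  refine coeff_substSeries_monomial_of_forall_ne hμ a β ?_
  rintro c rfl
  rw [map_nsmul, smul_eq_mul] at hν
  rcases c with _ | c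
  · simp at h0
  · nlinarith

theorem coeff_X_add_X_pow (c : ℕ) (ν : Fin 2 →₀ ℕ) :
    coeff ν ((X 0 + X 1 : MvPowerSeries (Fin 2) k) ^ c) =
      if ν.degree = c then ((c.choose (ν 0) : ℕ) : k) else 0 := by
  classical
  have hX : ∀ i j n : ℕ, coeff ν (X 0 ^ i * X 1 ^ j * ((n : ℕ) : MvPowerSeries (Fin 2) k)) =
      if ν 0 = i ∧ ν 1 = j then (n : k) else 0 := by
    intro i j n
    rw [X_pow_eq, X_pow_eq, monomial_mul_monomial, ← map_natCast (C (σ := Fin 2) (R := k)),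
      coeff_mul_C, coeff_monomial]
    have : ν = Finsupp.single 0 i + Finsupp.single 1 j ↔ ν 0 = i ∧ ν 1 = j := by
      rw [Finsupp.ext_iff, Fin.forall_fin_two]
      simp
    simp only [this]
    split_ifs <;> simp
  rw [add_pow, map_sum]
  simp only [hX]
  rw [Finsupp.degree_eq_sum, Fin.sum_univ_two]
  split_ifs with h
  · rw [sum_eq_single (ν 0)]
    · rw [if_pos ⟨rfl, by omega⟩]
    · intro i _ hi
      rw [if_neg fun h => hi h.1.symm]
    · simp
      omega
  · refine sum_eq_zero fun i hi => if_neg fun h' => h ?_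
    rw [mem_range] at hi
    omega

theorem exists_not_dvd_choose {p e : ℕ} (hp : p.Prime) (he : 2 ≤ e) (hpow : ∀ r, e ≠ p ^ r) :
    ∃ j, 0 < j ∧ j < e ∧ ¬ p ∣ e.choose j := by
  have := Fact.mk hp
  obtain ⟨r, u, hu, rfl⟩ := Nat.exists_eq_pow_mul_and_not_dvd (n := e) (by omega) p hp.ne_one
  have hlucas : ∀ r, (p ^ r * u).choose (p ^ r) ≡ u [MOD p] := by
    intro r
    induction r with
    | zero => simp [Nat.ModEq.refl]
    | succ r ih =>
      refine (Choose.choose_modEq_choose_mod_mul_choose_div_nat (p := p)).trans ?_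
      rw [pow_succ', mul_assoc, Nat.mul_mod_right, Nat.mul_mod_right,
        Nat.mul_div_cancel_left _ hp.pos, Nat.mul_div_cancel_left _ hp.pos]
      simpa using ih
  refine ⟨p ^ r, pow_pos hp.pos r, ?_, fun h => hu ?_⟩
  · have hu0 : u ≠ 0 := by rintro rfl; simp at hu
    have hu1 : u ≠ 1 := by rintro rfl; exact hpow r (mul_one _)
    exact lt_mul_of_one_lt_right (pow_pos hp.pos r) (by omega)
  · exact ((hlucas r).dvd_iff dvd_rfl).1 h

/-- The elements some multiple of which, by a number prime to `p`, lies in `K`. -/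
def primeToSaturation {H : Type*} [AddCommGroup H] {p : ℕ} (hp : p.Prime) (K : AddSubgroup H) :
    AddSubgroup H where
  carrier := {x | ∃ N : ℕ, ¬ p ∣ N ∧ N • x ∈ K}
  zero_mem' := ⟨1, hp.not_dvd_one, by simp⟩
  neg_mem' := by
    rintro x ⟨N, hN, h⟩
    exact ⟨N, hN, by rw [smul_neg]; exact K.neg_mem h⟩
  add_mem' := by
    rintro x y ⟨N, hN, hx⟩ ⟨M, hM, hy⟩
    refine ⟨N * M, fun h => (hp.dvd_mul.1 h).elim hN hM, ?_⟩
    rw [smul_add]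
    refine K.add_mem ?_ ?_
    · rw [mul_comm, mul_smul]
      exact K.nsmul_mem hx M
    · rw [mul_smul]
      exact K.nsmul_mem hy N

theorem mem_of_forall_prime_exists_nsmul_mem {H : Type*} [AddCommGroup H] {K : AddSubgroup H}
    {x : H} (h : ∀ p : ℕ, p.Prime → ∃ N : ℕ, ¬ p ∣ N ∧ N • x ∈ K) : x ∈ K := by
  let y : H ⧸ K := QuotientAddGroup.mk x
  have hy : ∀ N : ℕ, N • y = 0 ↔ N • x ∈ K := fun N => QuotientAddGroup.eq_zero_iff (N • x)
  have h1 : addOrderOf y = 1 := by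
    by_contra hne
    obtain ⟨p, hp, hdvd⟩ := Nat.exists_prime_and_dvd hne
    obtain ⟨N, hN, hNx⟩ := h p hp
    exact hN (hdvd.trans (addOrderOf_dvd_of_nsmul_eq_zero ((hy N).2 hNx)))
  simpa using (hy 1).1 (h1 ▸ addOrderOf_nsmul_eq_zero y)

theorem mem_iSup_properDivisors {H : Type*} [AddCommGroup H] (O : ℕ → AddSubgroup H)
    (h0 : O 0 = ⊥) (h1 : O 1 = ⊥) {c : ℕ} (hc : 2 ≤ c)
    (hchoose : ∀ l, 2 ≤ l → l ≤ c → ∀ j, 0 < j → j < l → ∀ x ∈ O l,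
      l.choose j • x ∈ ⨆ e ∈ l.properDivisors, O e)
    {x : H} (hx : x ∈ O c) (hx' : x ∈ ⨆ e ∈ range c, O e) :
    x ∈ ⨆ e ∈ c.properDivisors, O e := by
  refine mem_of_forall_prime_exists_nsmul_mem fun p hp => ?_
  by_cases hpow : ∃ s, c = p ^ s
  · obtain ⟨s, rfl⟩ := hpow
    suffices h : ∀ e, e < p ^ s →
        O e ≤ primeToSaturation hp (⨆ e ∈ (p ^ s).properDivisors, O e) from
      (iSup₂_le fun e he => h e (mem_range.1 he) :
        (⨆ e ∈ range (p ^ s), O e) ≤ primeToSaturation hp _) hx'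
    intro e
    induction e using Nat.strong_induction_on with
    | _ e ih =>
      intro he y hy
      by_cases he2 : e < 2
      · have hy0 : y = 0 := by
          interval_cases e
          · rwa [h0] at hy
          · rwa [h1] at hy
        rw [hy0]
        exact zero_mem _
      by_cases her : ∃ r, e = p ^ r
      · obtain ⟨r, rfl⟩ := her
        have hrs : r < s := (Nat.pow_lt_pow_iff_right hp.one_lt).1 he
        refine ⟨1, hp.not_dvd_one, ?_⟩
        rw [one_smul]
        exact (le_iSup₂_of_le (p ^ r)
          (Nat.mem_properDivisors.2 ⟨pow_dvd_pow p hrs.le, he⟩) le_rfl :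
            O (p ^ r) ≤ ⨆ e ∈ (p ^ s).properDivisors, O e) hy
      · push Not at her
        obtain ⟨j, hj0, hje, hj⟩ := exists_not_dvd_choose hp (by omega) her
        have hmem := hchoose e (by omega) he.le j hj0 hje y hy
        obtain ⟨N, hN, hNy⟩ := (iSup₂_le fun d hd =>
          ih d (Nat.mem_properDivisors.1 hd).2 ((Nat.mem_properDivisors.1 hd).2.trans he) :
          (⨆ d ∈ e.properDivisors, O d) ≤ primeToSaturation hp _) hmem
        refine ⟨N * e.choose j, fun h => (hp.dvd_mul.1 h).elim hN hj, ?_⟩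
        rwa [mul_smul]
  · push Not at hpow
    obtain ⟨j, hj0, hjc, hj⟩ := exists_not_dvd_choose hp hc hpow
    exact ⟨_, hj, hchoose c hc le_rfl j hj0 hjc x hx⟩

variable (k A) in
/-- The Hochschild coboundary of linear endomorphisms. -/
def coboundary : Module.End k A →+ (A → A → A) where
  toFun f x y := f (x * y) - f x * y - x * f y
  map_zero' := by ext; simp
  map_add' f g := by
    ext x y
    simp only [LinearMap.add_apply, Pi.add_apply, add_mul, mul_add]
    abel

theorem StartsAt.defect_eq {m : ℕ} {α : MvPowerSeries σ (Module.End k A)} (hα0 : coeff 0 α = 1)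
    (hα : StartsAt m α) {ν : σ →₀ ℕ} (hν0 : ν ≠ 0) (hν : ν.degree ≤ m) :
    defect α ν = coboundary k A (coeff ν α) := by
  classical
  ext x y
  rw [defect_apply, ← sum_subset (s₁ := {(ν, 0), (0, ν)})]
  · rw [sum_pair (by simp [hν0])]
    simp [hα0, coboundary, sub_sub, -coeff_zero_eq_constantCoeff]
  · intro p
    simp only [mem_insert, mem_singleton, HasAntidiagonal.mem_antidiagonal]
    rintro (rfl | rfl) <;> simp
  · rintro ⟨a, b⟩ h hne
    have ha : a ≠ 0 := by rintro rfl; simp_all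
    have hb : b ≠ 0 := by rintro rfl; simp_all
    rw [hα a ha (lt_of_lt_of_le (degree_lt_of_mem_antidiagonal h hb) hν)]
    simp

/-- The class of the defect modulo coboundaries. -/
noncomputable def obstruction (α : MvPowerSeries σ (Module.End k A)) (ν : σ →₀ ℕ) :
    (A → A → A) ⧸ (coboundary k A).range :=
  QuotientAddGroup.mk (defect α ν)

theorem IsHS.obstruction_mul {n : ℕ} {α β : MvPowerSeries σ (Module.End k A)} (hα : IsHS n α)
    (hβ : IsHS n β) {ν : σ →₀ ℕ} (hν : ν.degree ≤ n) :
    obstruction (α * β) ν = obstruction α ν + obstruction β ν := by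
  rw [obstruction, hα.defect_mul hβ hν]
  rfl

theorem obstruction_eq_zero_of_defect {α : MvPowerSeries σ (Module.End k A)} {ν : σ →₀ ℕ}
    (h : defect α ν = 0) : obstruction α ν = 0 := by
  rw [obstruction, h]
  rfl

variable (k A) in
/-- Obstructions to extending one-variable Hasse–Schmidt series of length `l` by one step. -/
def obstructionGroup (l : ℕ) : AddSubgroup ((A → A → A) ⧸ (coboundary k A).range) where
  carrier := {h | ∃ β : PowerSeries (Module.End k A), IsHS l β ∧
    obstruction β (Finsupp.single () l) = h}
  zero_mem' := ⟨1, isHS_one l, obstruction_eq_zero_of_defect (defect_one _)⟩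
  add_mem' := by
    rintro _ _ ⟨β, hβ, rfl⟩ ⟨γ, hγ, rfl⟩
    exact ⟨β * γ, hβ.mul hγ, hβ.obstruction_mul hγ (by simp)⟩
  neg_mem' := by
    rintro _ ⟨β, hβ, rfl⟩
    obtain ⟨γ, -, hγ, hd, -⟩ := hβ.exists_inv
    refine ⟨γ, hγ, ?_⟩
    rw [obstruction, hd _ (by simp)]
    rfl

variable (k A) in
/-- The linear terms of one-variable Hasse–Schmidt series of length `c`. -/
def leadingTerms (c : ℕ) : Submodule k (Module.End k A) where
  carrier := {D | ∃ β : PowerSeries (Module.End k A), IsHS c β ∧ PowerSeries.coeff 1 β = D}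
  zero_mem' := ⟨1, isHS_one c, by simp [PowerSeries.coeff_one]⟩
  add_mem' := by
    rintro _ _ ⟨β, hβ, rfl⟩ ⟨γ, hγ, rfl⟩
    exact ⟨β * γ, hβ.mul hγ, (StartsAt.one β).coeff_mul hβ.1 hγ.1 (by simp) (by simp)⟩
  smul_mem' := by
    rintro a _ ⟨β, hβ, rfl⟩
    have h1 : (Finsupp.single () 1 : Unit →₀ ℕ) ≠ 0 := by simp
    refine ⟨substSeries (monomial (Finsupp.single () 1) a) β,
      hβ.substSeries (constantCoeff_monomial_of_ne_zero h1 a), ?_⟩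
    simpa using coeff_nsmul_substSeries_monomial h1 a β 1

theorem leadingTerms_antitone : Antitone (leadingTerms k A) := by
  rintro c d h _ ⟨β, hβ, rfl⟩
  exact ⟨β, hβ.mono h, rfl⟩

theorem isHS_iff_powerSeries {n : ℕ} {β : PowerSeries (Module.End k A)} :
    IsHS n β ↔ PowerSeries.coeff 0 β = 1 ∧ ∀ i < n, defect β (Finsupp.single () i) = 0 := by
  refine and_congr ?_ ⟨fun h i hi => h _ (by simpa using hi), fun h ν hν => ?_⟩
  · rw [PowerSeries.coeff, Finsupp.single_zero]
  · obtain ⟨i, rfl⟩ : ∃ i, ν = Finsupp.single () i := ⟨ν (), by ext; simp⟩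
    exact h i (by simpa using hν)

theorem defect_congr {β γ : PowerSeries (Module.End k A)} {c : ℕ}
    (h : ∀ i ≤ c, PowerSeries.coeff i β = PowerSeries.coeff i γ) :
    defect β (Finsupp.single () c) = defect γ (Finsupp.single () c) := by
  ext x y
  rw [defect_single_apply, defect_single_apply, h c le_rfl]
  congr 1
  refine sum_congr rfl fun p hp => ?_
  rw [HasAntidiagonal.mem_antidiagonal] at hp
  rw [h p.1 (by omega), h p.2 (by omega)]

theorem defect_sub_monomial {β : PowerSeries (Module.End k A)} (h0 : PowerSeries.coeff 0 β = 1)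
    {c : ℕ} (hc : 1 ≤ c) (f : Module.End k A) :
    defect (β - PowerSeries.monomial c f) (Finsupp.single () c) =
      defect β (Finsupp.single () c) - coboundary k A f := by
  ext x y
  have hco : ∀ i, PowerSeries.coeff i (β - PowerSeries.monomial c f) =
      PowerSeries.coeff i β - if i = c then f else 0 := by
    intro i
    rw [map_sub, PowerSeries.coeff_monomial]
  have hsum : ∑ p ∈ antidiagonal c, PowerSeries.coeff p.1 (β - PowerSeries.monomial c f) x *
        PowerSeries.coeff p.2 (β - PowerSeries.monomial c f) y =
      ∑ p ∈ antidiagonal c, PowerSeries.coeff p.1 β x * PowerSeries.coeff p.2 β y -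
        (f x * y + x * f y) := by
    rw [eq_sub_iff_add_eq, ← eq_sub_iff_add_eq', ← sum_sub_distrib,
      ← sum_subset (s₁ := {(c, 0), (0, c)})]
    · rw [sum_pair (by simp; omega)]
      simp [hco, h0, (show (0 : ℕ) ≠ c by omega), sub_mul, mul_sub,
        -PowerSeries.coeff_zero_eq_constantCoeff]
    · intro p
      simp only [mem_insert, mem_singleton, HasAntidiagonal.mem_antidiagonal]
      rintro (rfl | rfl) <;> simp
    · rintro ⟨a, b⟩ h hne
      simp only [HasAntidiagonal.mem_antidiagonal, mem_insert, mem_singleton, Prod.mk.injEq]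
        at h hne
      rw [hco, hco, if_neg (by omega), if_neg (by omega)]
      simp
  rw [Pi.sub_apply, Pi.sub_apply, defect_single_apply, hsum, hco, if_pos rfl, defect_single_apply]
  simp only [coboundary, AddMonoidHom.coe_mk, ZeroHom.coe_mk, LinearMap.sub_apply]
  abel

theorem IsHS.exists_succ {c : ℕ} (hc : 1 ≤ c) {β : PowerSeries (Module.End k A)} (hβ : IsHS c β)
    (hob : obstruction β (Finsupp.single () c) = 0) :
    ∃ γ : PowerSeries (Module.End k A), IsHS (c + 1) γ ∧
      ∀ i < c, PowerSeries.coeff i γ = PowerSeries.coeff i β := by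
  rw [obstruction, QuotientAddGroup.eq_zero_iff] at hob
  obtain ⟨f, hf⟩ := hob
  have hco : ∀ i < c, PowerSeries.coeff i (β - PowerSeries.monomial c f) =
      PowerSeries.coeff i β := by
    intro i hi
    rw [map_sub, PowerSeries.coeff_monomial, if_neg (by omega), sub_zero]
  rw [isHS_iff_powerSeries] at hβ
  refine ⟨β - PowerSeries.monomial c f, ?_, hco⟩
  rw [isHS_iff_powerSeries]
  refine ⟨by rw [hco 0 hc, hβ.1], fun i hi => ?_⟩
  rcases (Nat.lt_succ_iff.1 hi).lt_or_eq with hi | rfl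
  · rw [defect_congr fun j hj => hco j (by omega), hβ.2 i hi]
  · rw [defect_sub_monomial hβ.1 hc, hf, sub_self]

theorem obstructionGroup_zero : obstructionGroup k A 0 = ⊥ := by
  rw [eq_bot_iff]
  rintro _ ⟨β, hβ, rfl⟩
  refine obstruction_eq_zero_of_defect ?_
  rw [Finsupp.single_zero]
  exact defect_zero hβ.1

theorem obstructionGroup_one : obstructionGroup k A 1 = ⊥ := by
  rw [eq_bot_iff]
  rintro _ ⟨β, hβ, rfl⟩
  rw [AddSubgroup.mem_bot, obstruction, (StartsAt.one β).defect_eq hβ.1 (by simp) (by simp),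
    QuotientAddGroup.eq_zero_iff]
  exact ⟨_, rfl⟩

theorem mem_leadingTerms_one (D : Module.End k A) : D ∈ leadingTerms k A 1 := by
  refine ⟨1 + PowerSeries.monomial 1 D, ?_, by simp [PowerSeries.coeff_one]⟩
  rw [isHS_iff_powerSeries]
  have h0 : PowerSeries.coeff 0 (1 + PowerSeries.monomial 1 D) = 1 := by
    rw [map_add, PowerSeries.coeff_monomial]
    simp
  refine ⟨h0, fun i hi => ?_⟩
  obtain rfl : i = 0 := by omega
  rw [Finsupp.single_zero]
  refine defect_zero ?_
  rwa [PowerSeries.coeff, Finsupp.single_zero] at h0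

theorem mem_leadingTerms_two {D : Module.End k A} (hD : coboundary k A D = 0) :
    D ∈ leadingTerms k A 2 := by
  obtain ⟨β, hβ, rfl⟩ := mem_leadingTerms_one D
  refine ⟨β, ?_, rfl⟩
  have h1 := hβ
  rw [isHS_iff_powerSeries] at hβ ⊢
  refine ⟨hβ.1, fun i hi => ?_⟩
  rcases Nat.lt_succ_iff_lt_or_eq.1 hi with hi | rfl
  · exact hβ.2 i hi
  · rw [(StartsAt.one β).defect_eq h1.1 (by simp) (by simp)]
    exact hD

variable (k A) in
/-- Obstructions of one-variable Hasse–Schmidt series with vanishing linear term. -/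
def higherObstructionGroup (l : ℕ) : AddSubgroup ((A → A → A) ⧸ (coboundary k A).range) where
  carrier := {h | ∃ β : PowerSeries (Module.End k A), IsHS l β ∧ PowerSeries.coeff 1 β = 0 ∧
    obstruction β (Finsupp.single () l) = h}
  zero_mem' := ⟨1, isHS_one l, by simp [PowerSeries.coeff_one],
    obstruction_eq_zero_of_defect (defect_one _)⟩
  add_mem' := by
    rintro _ _ ⟨β, hβ, hβ1, rfl⟩ ⟨γ, hγ, hγ1, rfl⟩
    refine ⟨β * γ, hβ.mul hγ, ?_, hβ.obstruction_mul hγ (by simp)⟩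
    refine ((StartsAt.one β).coeff_mul hβ.1 hγ.1 (by simp) (by simp)).trans ?_
    exact (congrArg₂ _ hβ1 hγ1).trans (add_zero 0)
  neg_mem' := by
    rintro _ ⟨β, hβ, hβ1, rfl⟩
    obtain ⟨γ, -, hγ, hd, hco⟩ := hβ.exists_inv
    refine ⟨γ, hγ, ?_, ?_⟩
    · refine (hco 1 (StartsAt.one β) (Finsupp.single () 1) (by simp) (by simp)).trans ?_
      exact (congrArg _ hβ1).trans neg_zero
    · rw [obstruction, hd _ (by simp)]
      rfl

theorem iSup_properDivisors_le_higherObstructionGroup (c : ℕ) :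
    ⨆ e ∈ c.properDivisors, obstructionGroup k A e ≤ higherObstructionGroup k A c := by
  refine iSup₂_le fun e he => ?_
  rw [Nat.mem_properDivisors] at he
  obtain ⟨⟨d, rfl⟩, hlt⟩ := he
  have hd : 2 ≤ d := by
    rcases d with _ | _ | d
    · simp at hlt
    · simp at hlt
    · omega
  have hμ : (Finsupp.single () d : Unit →₀ ℕ) ≠ 0 := by simp; omega
  rintro _ ⟨β, hβ, rfl⟩
  refine ⟨substSeries (monomial (Finsupp.single () d) (1 : k)) β, ?_, ?_, ?_⟩
  · have := hβ.substSeries_monomial hμ (1 : k)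
    rwa [Finsupp.degree_single, mul_comm] at this
  · exact startsAt_substSeries_monomial hμ 1 β (Finsupp.single () 1) (by simp)
      (by simpa using by omega)
  · have := defect_nsmul_substSeries_monomial hμ (1 : k) β e
    rw [Finsupp.smul_single, smul_eq_mul, one_pow, one_smul] at this
    rw [obstruction, this]
    rfl

variable (k A) in
/-- Every lowest coefficient, in degree `m`, of a two-variable Hasse–Schmidt series of length
greater than `m * c` is the linear term of a one-variable one of length `c + 1`. -/
def LeadingTermsDescend (c : ℕ) : Prop :=
  ∀ (m n : ℕ) (α : MvPowerSeries (Fin 2) (Module.End k A)), 1 ≤ m → m * c < n → IsHS n α →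
    StartsAt m α → ∀ μ : Fin 2 →₀ ℕ, μ.degree = m → coeff μ α ∈ leadingTerms k A (c + 1)

theorem obstruction_mem_insert_step {m n c : ℕ} {α : MvPowerSeries σ (Module.End k A)}
    (hm : 1 ≤ m) (hn : n ≤ m * c) (hα : IsHS n α) (hs : StartsAt m α) {μ : σ →₀ ℕ}
    (hμ : μ.degree = m) {β : PowerSeries (Module.End k A)} (hβ : IsHS c β)
    (hβ1 : PowerSeries.coeff 1 β = coeff μ α) :
    ∃ α', IsHS n α' ∧ StartsAt m α' ∧ coeff μ α' = 0 ∧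
      (∀ μ' : σ →₀ ℕ, μ'.degree = m → μ' ≠ μ → coeff μ' α' = coeff μ' α) ∧
      ∀ ν : σ →₀ ℕ, ν.degree ≤ n → obstruction α ν =
        obstruction α' ν + obstruction (substSeries (monomial μ (1 : k)) β) ν := by
  have hμ0 : μ ≠ 0 := by
    rintro rfl
    simp at hμ
    omega
  have hS : IsHS n (substSeries (monomial μ (1 : k)) β) :=
    (hβ.substSeries_monomial hμ0 1).mono (by rwa [hμ])
  have hSs := startsAt_substSeries_monomial hμ0 (1 : k) β
  rw [hμ] at hSs
  obtain ⟨γ, -, hγ, hd, hco⟩ := hS.exists_inv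
  have hγco := hco m hSs
  have hαγ : ∀ μ' : σ →₀ ℕ, μ'.degree = m → coeff μ' (α * γ) =
      coeff μ' α - coeff μ' (substSeries (monomial μ (1 : k)) β) := by
    intro μ' hμ'
    have h0 : μ' ≠ 0 := by
      rintro rfl
      simp at hμ'
      omega
    rw [hs.coeff_mul hα.1 hγ.1 h0 hμ'.le, hγco μ' h0 hμ'.le, sub_eq_add_neg]
  refine ⟨α * γ, hα.mul hγ, hs.mul hα.1 hγ.1 fun ν h0 h => ?_, ?_, fun μ' hμ' hne => ?_,
    fun ν hν => ?_⟩
  · rw [hγco ν h0 h.le, hSs ν h0 h, neg_zero]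
  · have := coeff_nsmul_substSeries_monomial hμ0 (1 : k) β 1
    rw [one_smul, one_pow, one_smul] at this
    rw [hαγ μ hμ, this, hβ1, sub_self]
  · rw [hαγ μ' hμ', coeff_substSeries_monomial_of_forall_ne hμ0, sub_zero]
    rintro e rfl
    rw [map_nsmul, hμ, smul_eq_mul] at hμ'
    have : e = 1 := Nat.eq_of_mul_eq_mul_right (by omega) (hμ'.trans (one_mul m).symm)
    exact hne (by rw [this, one_smul])
  · rw [hα.obstruction_mul hγ hν]
    have : obstruction γ ν = -obstruction (substSeries (monomial μ (1 : k)) β) ν := by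
      rw [obstruction, hd ν hν]
      rfl
    rw [this, neg_add_cancel_right]

theorem obstruction_mem {c : ℕ} (hP : ∀ c' < c, LeadingTermsDescend k A c') {n : ℕ} (hn : 1 ≤ n)
    {ν : Fin 2 →₀ ℕ} (hν : ν.degree = n) (K : AddSubgroup ((A → A → A) ⧸ (coboundary k A).range))
    {m : ℕ} (hm : 1 ≤ m) (hnm : n ≤ m * c) {α : MvPowerSeries (Fin 2) (Module.End k A)}
    (hα : IsHS n α) (hs : StartsAt m α)
    (hK : ∀ (e : ℕ) (μ : Fin 2 →₀ ℕ), ν = e • μ → m ≤ μ.degree →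
      (μ.degree = m → coeff μ α ≠ 0) → obstructionGroup k A e ≤ K) :
    obstruction α ν ∈ K := by
  classical
  have hν0 : ν ≠ 0 := by
    rintro rfl
    simp at hν
    omega
  induction hd : n + 1 - m generalizing m α with
  | zero =>
    have : defect α ν = 0 := by
      rw [hs.defect_eq hα.1 hν0 (by omega), hs ν hν0 (by omega), map_zero]
    rw [obstruction_eq_zero_of_defect this]
    exact zero_mem K
  | succ d ihd =>
    have hc' : m * ((n - 1) / m) < n ∧ n ≤ m * ((n - 1) / m + 1) ∧ (n - 1) / m < c := by
      have h1 := Nat.div_add_mod (n - 1) m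
      have h2 := Nat.mod_lt (n - 1) (show m > 0 by omega)
      refine ⟨by omega, by rw [mul_add]; omega, ?_⟩
      rw [Nat.div_lt_iff_lt_mul (by omega), mul_comm]
      omega
    obtain ⟨hc1, hc2, hc3⟩ := hc'
    have hT : ∀ T : Finset (Fin 2 →₀ ℕ), ∀ α : MvPowerSeries (Fin 2) (Module.End k A),
        IsHS n α → StartsAt m α → (∀ μ : Fin 2 →₀ ℕ, μ.degree = m → coeff μ α ≠ 0 → μ ∈ T) →
        (∀ (e : ℕ) (μ : Fin 2 →₀ ℕ), ν = e • μ → m ≤ μ.degree →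
          (μ.degree = m → coeff μ α ≠ 0) → obstructionGroup k A e ≤ K) →
        obstruction α ν ∈ K := by
      intro T
      induction T using Finset.induction_on with
      | empty =>
        intro α hα hs hT hK
        refine ihd (m := m + 1) (by omega) (hnm.trans (Nat.mul_le_mul_right c (by omega))) hα ?_ ?_
          (by omega)
        · intro μ h0 h
          rcases Nat.lt_succ_iff_lt_or_eq.1 h with h | h
          · exact hs μ h0 h
          · by_contra hne
            simpa using hT μ h hne
        · intro e μ h1 h2 _
          exact hK e μ h1 (by omega) (by omega)
      | insert μ T _ ihT =>
        intro α hα hs hT hK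
        by_cases hμ : μ.degree = m ∧ coeff μ α ≠ 0
        · obtain ⟨hμm, hμα⟩ := hμ
          obtain ⟨β, hβ, hβ1⟩ := hP _ hc3 m n α hm hc1 hα hs μ hμm
          obtain ⟨α', hα', hs', hμ', hco, hob⟩ :=
            obstruction_mem_insert_step hm hc2 hα hs hμm hβ hβ1
          have hne : ∀ μ' : Fin 2 →₀ ℕ, μ'.degree = m → coeff μ' α' ≠ 0 →
              μ' ≠ μ ∧ coeff μ' α ≠ 0 := by
            intro μ' h1 h2
            have h3 : μ' ≠ μ := by
              rintro rfl
              exact h2 hμ'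
            exact ⟨h3, by rwa [← hco μ' h1 h3]⟩
          rw [hob ν hν.le]
          refine K.add_mem (ihT α' hα' hs' ?_ ?_) ?_
          · intro μ' h1 h2
            exact mem_of_mem_insert_of_ne (hT μ' h1 (hne μ' h1 h2).2) (hne μ' h1 h2).1
          · intro e μ' h1 h2 h3
            exact hK e μ' h1 h2 fun h => (hne μ' h (h3 h)).2
          · have hμ0 : μ ≠ 0 := by
              rintro rfl
              simp at hμm
              omega
            by_cases he : ∃ e : ℕ, ν = e • μ
            · obtain ⟨e, he⟩ := he
              refine hK e μ he hμm.ge (fun _ => hμα) ⟨β, hβ.mono ?_, ?_⟩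
              · rw [he, map_nsmul, hμm, smul_eq_mul, mul_comm] at hν
                exact Nat.le_of_mul_le_mul_left (hν.trans_le hc2) hm
              · rw [he, obstruction, obstruction, defect_nsmul_substSeries_monomial hμ0, one_pow,
                  one_smul]
            · push Not at he
              rw [obstruction_eq_zero_of_defect
                (defect_substSeries_monomial_of_forall_ne hμ0 1 β he)]
              exact zero_mem K
        · refine ihT α hα hs (fun μ' h1 h2 => ?_) hK
          refine mem_of_mem_insert_of_ne (hT μ' h1 h2) ?_
          rintro rfl
          exact hμ ⟨h1, h2⟩
    refine hT (finsuppAntidiag univ m) α hα hs (fun μ h _ => ?_) hK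
    rw [mem_finsuppAntidiag]
    exact ⟨by rw [← h, Finsupp.degree_eq_sum], subset_univ _⟩

theorem coeff_substSeries_of_degree_eq_one {u : MvPowerSeries σ k} (hu : constantCoeff u = 0)
    (β : PowerSeries (Module.End k A)) {ν : σ →₀ ℕ} (hν : ν.degree = 1) :
    coeff ν (substSeries u β) = coeff ν u • PowerSeries.coeff 1 β := by
  classical
  have h0 : ν ≠ 0 := by
    rintro rfl
    simp at hν
  rw [coeff_substSeries hu β hν.le, sum_range_succ, sum_range_one, pow_zero, coeff_one, if_neg h0,
    zero_smul, zero_add, pow_one]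

theorem IsHS.defect_substSeries_of_degree_eq {u : MvPowerSeries σ k} (hu : constantCoeff u = 0)
    {n : ℕ} {β : PowerSeries (Module.End k A)} (hβ : IsHS n β) {ν : σ →₀ ℕ} (hν : ν.degree = n) :
    defect (HasseSchmidt.substSeries u β) ν =
      coeff ν (u ^ n) • defect β (Finsupp.single () n) := by
  rw [defect_substSeries hu, hν, sum_range_succ, sum_eq_zero, zero_add]
  intro c hc
  rw [hβ.2 _ (by simpa using hc), smul_zero]

theorem choose_nsmul_mem {c : ℕ} (hP : ∀ c' < c, LeadingTermsDescend k A c') {l : ℕ}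
    (hl : 2 ≤ l) (hlc : l ≤ c) {j : ℕ} (hj0 : 0 < j) (hjl : j < l)
    {x : (A → A → A) ⧸ (coboundary k A).range} (hx : x ∈ obstructionGroup k A l) :
    l.choose j • x ∈ ⨆ e ∈ l.properDivisors, obstructionGroup k A e := by
  classical
  obtain ⟨β, hβ, rfl⟩ := hx
  have hX0 : constantCoeff (X 0 : MvPowerSeries (Fin 2) k) = 0 := constantCoeff_X 0
  have hX1 : constantCoeff (X 1 : MvPowerSeries (Fin 2) k) = 0 := constantCoeff_X 1
  have hX : constantCoeff (X 0 + X 1 : MvPowerSeries (Fin 2) k) = 0 := by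
    rw [map_add, hX0, hX1, add_zero]
  have hβ0 := hβ.substSeries hX0
  have hβ1 := hβ.substSeries hX1
  have hβX := hβ.substSeries hX
  obtain ⟨γ, -, hγ, hd, hco⟩ := hβX.exists_inv
  set ν : Fin 2 →₀ ℕ := Finsupp.single 0 j + Finsupp.single 1 (l - j) with hνdef
  have hν : ν.degree = l := by
    rw [hνdef, map_add, Finsupp.degree_single, Finsupp.degree_single]
    omega
  have hν0 : ν 0 = j := by simp [hνdef]
  have hν1 : ν 1 = l - j := by simp [hνdef]
  have hd0 : defect (substSeries (X 0 : MvPowerSeries (Fin 2) k) β) ν = 0 := by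
    rw [hβ.defect_substSeries_of_degree_eq hX0 hν, coeff_X_pow, if_neg, zero_smul]
    intro h
    have := DFunLike.congr_fun h 1
    simp [hν1] at this
    omega
  have hd1 : defect (substSeries (X 1 : MvPowerSeries (Fin 2) k) β) ν = 0 := by
    rw [hβ.defect_substSeries_of_degree_eq hX1 hν, coeff_X_pow, if_neg, zero_smul]
    intro h
    have := DFunLike.congr_fun h 0
    simp [hν0] at this
    omega
  have hdX : defect (substSeries (X 0 + X 1 : MvPowerSeries (Fin 2) k) β) ν =
      l.choose j • defect β (Finsupp.single () l) := by
    rw [hβ.defect_substSeries_of_degree_eq hX hν, coeff_X_add_X_pow, if_pos hν, hν0,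
      Nat.cast_smul_eq_nsmul]
  have hstart : StartsAt 2 (substSeries (X 0 : MvPowerSeries (Fin 2) k) β *
      substSeries (X 1 : MvPowerSeries (Fin 2) k) β * γ) := by
    intro ν' h0 h
    have h1 : ν'.degree = 1 := by
      have := (Finsupp.degree_eq_zero_iff ν').not.2 h0
      omega
    rw [(StartsAt.one _).coeff_mul (hβ0.mul hβ1).1 hγ.1 h0 h1.le,
      (StartsAt.one _).coeff_mul hβ0.1 hβ1.1 h0 h1.le, hco 1 (StartsAt.one _) ν' h0 h1.le,
      coeff_substSeries_of_degree_eq_one hX0 β h1, coeff_substSeries_of_degree_eq_one hX1 β h1,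
      coeff_substSeries_of_degree_eq_one hX β h1, map_add, add_smul, add_neg_cancel]
  have hob : obstruction (substSeries (X 0 : MvPowerSeries (Fin 2) k) β *
      substSeries (X 1 : MvPowerSeries (Fin 2) k) β * γ) ν =
      -(l.choose j • obstruction β (Finsupp.single () l)) := by
    rw [obstruction, (hβ0.mul hβ1).defect_mul hγ hν.le, hβ0.defect_mul hβ1 hν.le, hd0, hd1,
      hd ν hν.le, hdX, zero_add, zero_add]
    rfl
  rw [← neg_mem_iff, ← hob]
  refine obstruction_mem hP (n := l) (by omega) hν _ (m := 2) (by omega) (by omega)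
    ((hβ0.mul hβ1).mul hγ) hstart fun e μ he hμ _ => ?_
  refine le_iSup₂_of_le e (Nat.mem_properDivisors.2 ?_) le_rfl
  rw [he, map_nsmul, smul_eq_mul] at hν
  refine ⟨⟨_, hν.symm⟩, ?_⟩
  have : e ≠ 0 := by
    rintro rfl
    omega
  nlinarith

theorem leadingTermsDescend (c : ℕ) : LeadingTermsDescend k A c := by
  induction c using Nat.strong_induction_on with
  | _ c hP =>
  intro m n α hm hn hα hs μ hμ
  have hμ0 : μ ≠ 0 := by
    rintro rfl
    simp at hμ
    omega
  rcases c with _ | _ | c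
  · exact mem_leadingTerms_one _
  · refine mem_leadingTerms_two ?_
    rw [← hs.defect_eq hα.1 hμ0 hμ.le]
    exact hα.2 μ (by omega)
  · obtain ⟨β, hβ, hβ1⟩ := hP (c + 1) (by omega) m n α hm
      (lt_of_le_of_lt (Nat.mul_le_mul_left m (by omega)) hn) hα hs μ hμ
    have hα2 : IsHS (m * (c + 1 + 1)) α := hα.mono hn.le
    obtain ⟨α', hα', hs', hμ', -, hob⟩ :=
      obstruction_mem_insert_step hm le_rfl hα2 hs hμ hβ hβ1
    have hν : ((c + 1 + 1) • μ).degree = m * (c + 1 + 1) := by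
      rw [map_nsmul, hμ, smul_eq_mul, mul_comm]
    have hβob : obstruction (substSeries (monomial μ (1 : k)) β) ((c + 1 + 1) • μ) =
        obstruction β (Finsupp.single () (c + 1 + 1)) := by
      rw [obstruction, obstruction, defect_nsmul_substSeries_monomial hμ0, one_pow, one_smul]
    have hsum := hob ((c + 1 + 1) • μ) hν.le
    rw [obstruction_eq_zero_of_defect (hα.2 _ (by omega)), hβob] at hsum
    have hα'mem : obstruction α' ((c + 1 + 1) • μ) ∈
        ⨆ e ∈ range (c + 1 + 1), obstructionGroup k A e := by
      refine obstruction_mem hP (n := m * (c + 1 + 1)) (by nlinarith) hν _ hm le_rfl hα' hs'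
        fun e μ' he h1 h2 => ?_
      refine le_iSup₂_of_le e (mem_range.2 ?_) le_rfl
      have hdeg := congrArg Finsupp.degree he
      rw [hν, map_nsmul, smul_eq_mul] at hdeg
      by_contra hlt
      push Not at hlt
      have hm' : μ'.degree = m := by nlinarith
      have he' : e = c + 1 + 1 := by
        rw [hm', mul_comm] at hdeg
        exact (Nat.eq_of_mul_eq_mul_right (by omega) hdeg).symm
      rw [he'] at he
      refine h2 hm' ?_
      have : μ' = μ := by
        ext i
        have := DFunLike.congr_fun he i
        simp only [Finsupp.smul_apply, smul_eq_mul] at this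
        exact (Nat.eq_of_mul_eq_mul_left (by omega) this).symm
      rw [this, hμ']
    have hmem : obstruction β (Finsupp.single () (c + 1 + 1)) ∈
        ⨆ e ∈ (c + 1 + 1).properDivisors, obstructionGroup k A e := by
      refine mem_iSup_properDivisors _ obstructionGroup_zero obstructionGroup_one (by omega)
        (fun l h1 h2 j h3 h4 x hx => choose_nsmul_mem hP h1 h2 h3 h4 hx) ⟨β, hβ, rfl⟩ ?_
      rw [eq_neg_of_add_eq_zero_right hsum.symm]
      exact neg_mem hα'mem
    obtain ⟨ε, hε, hε1, hεob⟩ :=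
      iSup_properDivisors_le_higherObstructionGroup _ (neg_mem hmem)
    obtain ⟨γ, hγ, hγco⟩ := (hβ.mul hε).exists_succ (by omega) (by
      rw [hβ.obstruction_mul hε (by simp), hεob, add_neg_cancel])
    refine ⟨γ, hγ, ?_⟩
    rw [hγco 1 (by omega), ← hβ1]
    refine ((StartsAt.one β).coeff_mul hβ.1 hε.1 (by simp) (by simp)).trans ?_
    exact (congrArg _ hε1).trans (add_zero _)

theorem IsHS.coeff_mem_leadingTerms {m n c : ℕ} {β : PowerSeries (Module.End k A)}
    (hβ : IsHS n β) (hs : StartsAt m β) (hm : 1 ≤ m) (hn : m * c < n) :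
    PowerSeries.coeff m β ∈ leadingTerms k A (c + 1) := by
  have h0 : (Finsupp.single 0 1 : Fin 2 →₀ ℕ) ≠ 0 := by simp
  have h := coeff_nsmul_substSeries_monomial h0 (1 : k) β
  simp only [one_pow, one_smul] at h
  rw [← h m]
  refine leadingTermsDescend c m n _ hm hn
    (hβ.substSeries (constantCoeff_monomial_of_ne_zero h0 1)) (fun ν hν0 hν => ?_) _ (by simp)
  by_cases hc : ∃ e : ℕ, ν = e • Finsupp.single 0 1
  · obtain ⟨e, rfl⟩ := hc
    have he : e ≠ 0 := by
      rintro rfl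
      simp at hν0
    rw [h e]
    exact hs (Finsupp.single () e) (by simpa using he) (by simpa using hν)
  · push Not at hc
    exact coeff_substSeries_monomial_of_forall_ne h0 1 β hc

theorem coeff_mul_of_coeff_eq {n : ℕ} {β β' γ : PowerSeries (Module.End k A)}
    (h : ∀ i < n, PowerSeries.coeff i β' = PowerSeries.coeff i β) (hinv : β' * γ = 1)
    (hγ : PowerSeries.coeff 0 γ = 1) {i : ℕ} (hi0 : i ≠ 0) (hi : i ≤ n) :
    PowerSeries.coeff i (β * γ) = PowerSeries.coeff i β - PowerSeries.coeff i β' := by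
  have heq : β * γ = 1 + (β - β') * γ := by
    rw [sub_mul, hinv, add_sub_cancel]
  rw [heq, map_add, PowerSeries.coeff_one, if_neg hi0, zero_add, PowerSeries.coeff_mul,
    sum_eq_single (i, 0)]
  · rw [hγ, mul_one, map_sub]
  · rintro ⟨a, b⟩ hab hne
    rw [HasAntidiagonal.mem_antidiagonal] at hab
    have : a < n := by
      by_contra ha
      refine hne (Prod.ext ?_ ?_) <;> simp only at hab ⊢ <;> omega
    rw [map_sub, h a this, sub_self, zero_mul]
  · simp

theorem startsAt_iff_powerSeries {m : ℕ} {β : PowerSeries (Module.End k A)} :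
    StartsAt m β ↔ ∀ i, i ≠ 0 → i < m → PowerSeries.coeff i β = 0 := by
  refine ⟨fun h i h0 hi => h _ (by simpa using h0) (by simpa using hi), fun h ν h0 hν => ?_⟩
  obtain ⟨i, rfl⟩ : ∃ i, ν = Finsupp.single () i := ⟨ν (), by ext; simp⟩
  exact h i (by simpa using h0) (by simpa using hν)

/-- Once the modules of linear terms are stable, truncations of sufficiently long Hasse–Schmidt
series extend to Hasse–Schmidt series of any length. -/
theorem IsHS.exists_extension {N : ℕ} (hN : 1 ≤ N)
    (hstable : ∀ M, leadingTerms k A N ≤ leadingTerms k A M) (M : ℕ) {n : ℕ} (hn : 1 ≤ n)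
    {β : PowerSeries (Module.End k A)} (hβ : IsHS (n * N) β) :
    ∃ β' : PowerSeries (Module.End k A), IsHS M β' ∧
      ∀ i < n, PowerSeries.coeff i β' = PowerSeries.coeff i β := by
  induction n, hn using Nat.le_induction generalizing M with
  | base =>
    refine ⟨1, isHS_one M, fun i hi => ?_⟩
    obtain rfl : i = 0 := by omega
    rw [(isHS_iff_powerSeries.1 hβ).1, PowerSeries.coeff_one, if_pos rfl]
  | succ n hn ih =>
    obtain ⟨β', hβ', hco⟩ := ih (max M ((n + 1) * N)) (hβ.mono (by nlinarith))
    obtain ⟨γ, hinv, hγ, -⟩ := (hβ'.mono (le_max_right _ _)).exists_inv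
    have hcoeff := fun i => coeff_mul_of_coeff_eq hco hinv (isHS_iff_powerSeries.1 hγ).1 (i := i)
    have hs : StartsAt n (β * γ) := startsAt_iff_powerSeries.2 fun i h0 hi => by
      rw [hcoeff i h0 hi.le, hco i hi, sub_self]
    have hmem := (hβ.mul hγ).coeff_mem_leadingTerms hs hn (c := N - 1) (by
      obtain ⟨N, rfl⟩ := Nat.exists_eq_add_of_le' hN
      rw [Nat.add_sub_cancel]
      nlinarith)
    rw [Nat.sub_add_cancel hN] at hmem
    obtain ⟨δ, hδ, hδ1⟩ := hstable M hmem
    rw [hcoeff n (by omega) le_rfl] at hδ1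
    have hμ : (Finsupp.single () n : Unit →₀ ℕ) ≠ 0 := by simp; omega
    have hδS := hδ.substSeries (constantCoeff_monomial_of_ne_zero hμ (1 : k))
    have hδs := startsAt_substSeries_monomial hμ (1 : k) δ
    rw [Finsupp.degree_single] at hδs
    have hβ'M := hβ'.mono (le_max_left _ _)
    have hmulco : ∀ i, i ≠ 0 → i ≤ n →
        PowerSeries.coeff i (HasseSchmidt.substSeries (monomial (Finsupp.single () n) (1 : k)) δ *
          β' : PowerSeries (Module.End k A)) =
        PowerSeries.coeff i (HasseSchmidt.substSeries (monomial (Finsupp.single () n) (1 : k)) δ :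
          PowerSeries (Module.End k A)) + PowerSeries.coeff i β' := fun i h0 hi =>
      hδs.coeff_mul hδS.1 hβ'M.1 (by simpa using h0) (by simpa using hi)
    have hlead : PowerSeries.coeff n (HasseSchmidt.substSeries
        (monomial (Finsupp.single () n) (1 : k)) δ : PowerSeries (Module.End k A)) =
        PowerSeries.coeff 1 δ := by
      have := coeff_nsmul_substSeries_monomial hμ (1 : k) δ 1
      rwa [one_smul, one_pow, one_smul] at this
    refine ⟨_, hδS.mul hβ'M, fun i hi => ?_⟩
    rcases eq_or_ne i 0 with rfl | h0
    · rw [(isHS_iff_powerSeries.1 (hδS.mul hβ'M)).1, (isHS_iff_powerSeries.1 hβ).1]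
    rw [hmulco i h0 (by omega)]
    rcases (Nat.lt_succ_iff.1 hi).lt_or_eq with hi | rfl
    · rw [startsAt_iff_powerSeries.1 hδs i h0 hi, zero_add, hco i hi]
    · rw [hlead, hδ1, sub_add_cancel]

theorem exists_isHS_of_mem_leadingTerms {N : ℕ} (hN : 1 ≤ N)
    (hstable : ∀ M, leadingTerms k A N ≤ leadingTerms k A M) {D : Module.End k A}
    (hD : D ∈ leadingTerms k A N) :
    ∃ β : PowerSeries (Module.End k A), (∀ n, IsHS n β) ∧ PowerSeries.coeff 1 β = D := by
  have hext : ∀ (n : ℕ) (β : PowerSeries (Module.End k A)),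
      ∃ β' : PowerSeries (Module.End k A), IsHS ((n + 2) * N) β → IsHS ((n + 3) * N) β' ∧
        ∀ i < n + 2, PowerSeries.coeff i β' = PowerSeries.coeff i β := by
    intro n β
    by_cases hβ : IsHS ((n + 2) * N) β
    · obtain ⟨β', h⟩ := hβ.exists_extension hN hstable ((n + 3) * N) (by omega)
      exact ⟨β', fun _ => h⟩
    · exact ⟨β, fun h => absurd h hβ⟩
  choose f hf using hext
  obtain ⟨β, hβ, rfl⟩ := hstable (2 * N) hD
  let b : ℕ → PowerSeries (Module.End k A) := fun n => Nat.rec β f n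
  have hb : ∀ n, IsHS ((n + 2) * N) (b n) := by
    intro n
    induction n with
    | zero =>
      rw [zero_add]
      exact hβ
    | succ n ih => exact (hf n (b n) ih).1
  have hco : ∀ i j, i ≤ j → PowerSeries.coeff i (b j) = PowerSeries.coeff i (b i) := by
    intro i j hij
    induction j, hij using Nat.le_induction with
    | base => rfl
    | succ j hij ih => exact ((hf j (b j) (hb j)).2 i (by omega)).trans ih
  refine ⟨PowerSeries.mk fun i => PowerSeries.coeff i (b i), fun n => ?_, ?_⟩
  · refine isHS_iff_powerSeries.2 ⟨?_, fun i _ => ?_⟩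
    · rw [PowerSeries.coeff_mk, (isHS_iff_powerSeries.1 (hb 0)).1]
    · rw [defect_congr (γ := b i) fun j hj => by rw [PowerSeries.coeff_mk, hco j i hj]]
      exact (isHS_iff_powerSeries.1 (hb i)).2 i (by nlinarith)
  · rw [PowerSeries.coeff_mk]
    exact (hf 0 (b 0) (hb 0)).2 1 (by omega)

theorem exists_leadingTerms_le [IsArtinian k (Module.End k A)] :
    ∃ N, 1 ≤ N ∧ ∀ M, leadingTerms k A N ≤ leadingTerms k A M := by
  obtain ⟨N, hN⟩ := IsArtinian.monotone_stabilizes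
    (⟨fun n => OrderDual.toDual (leadingTerms k A n), fun _ _ h => leadingTerms_antitone h⟩ :
      ℕ →o (Submodule k (Module.End k A))ᵒᵈ)
  have hN' : ∀ M, N ≤ M → leadingTerms k A N = leadingTerms k A M := hN
  refine ⟨N + 1, by omega, fun M => ?_⟩
  rw [← hN' (N + 1) (by omega)]
  rcases le_total N M with h | h
  · exact (hN' M h).le
  · exact leadingTerms_antitone h

theorem defect_single_eq_zero_iff {β : PowerSeries (Module.End k A)} {i : ℕ} :
    defect β (Finsupp.single () i) = 0 ↔ ∀ x y : A, PowerSeries.coeff i β (x * y) =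
      ∑ j ∈ range (i + 1), PowerSeries.coeff j β x * PowerSeries.coeff (i - j) β y := by
  have h : ∀ x y : A, defect β (Finsupp.single () i) x y = PowerSeries.coeff i β (x * y) -
      ∑ j ∈ range (i + 1), PowerSeries.coeff j β x * PowerSeries.coeff (i - j) β y := by
    intro x y
    rw [defect_single_apply, Nat.sum_antidiagonal_eq_sum_range_succ
      (fun a b => PowerSeries.coeff a β x * PowerSeries.coeff b β y)]
  simp only [funext_iff, h, Pi.zero_apply, sub_eq_zero]

end HasseSchmidt

open HasseSchmidt in
/-- For an Artin algebra `A` over a commutative Artinian ring `k`, a derivation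
is `[m,n)`-integrable for every `n > m` iff it is `[m,∞]`-integrable. -/
theorem statement6 (k : Type*) [CommRing k] [IsArtinianRing k]
    (A : Type*) [Ring A] [Algebra k A] [Module.Finite k A]
    (m : ℕ) (hm : 1 ≤ m)
    (D : A →ₗ[k] A) (hD : IsDerivation k A D) :
    (∀ n, m < n → IsFinIntegrable k A m n D) ↔ IsInfIntegrable k A m D := by
  refine ⟨fun h => ?_, fun ⟨α, h0, hs, hαm, hα⟩ n _ => ⟨α, h0, hs, hαm, fun i _ => hα i⟩⟩
  have : IsArtinian k (Module.End k A) := inferInstanceAs (IsArtinian k (A →ₗ[k] A))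
  obtain ⟨N, hN, hstable⟩ := exists_leadingTerms_le (k := k) (A := A)
  have hmem : D ∈ leadingTerms k A N := by
    obtain ⟨α, h0, hs, rfl, hα⟩ := h (m * N + 1) (by nlinarith)
    have hHS : IsHS (m * N + 1) (PowerSeries.mk α) := by
      refine isHS_iff_powerSeries.2 ⟨?_, fun i hi => ?_⟩
      · rw [PowerSeries.coeff_mk, h0]
        rfl
      · rw [defect_single_eq_zero_iff]
        simpa only [PowerSeries.coeff_mk] using hα i hi
    have hstart : StartsAt m (PowerSeries.mk α) :=
      startsAt_iff_powerSeries.2 fun i hi0 hi => by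
        rw [PowerSeries.coeff_mk, hs i (by omega) hi]
    have := hHS.coeff_mem_leadingTerms hstart hm (c := N) (by omega)
    rw [PowerSeries.coeff_mk] at this
    exact leadingTerms_antitone (by omega) this
  obtain ⟨β, hβ, rfl⟩ := exists_isHS_of_mem_leadingTerms hN hstable hmem
  have hμ : (Finsupp.single () m : Unit →₀ ℕ) ≠ 0 := by
    simp
    omega
  let γ : PowerSeries (Module.End k A) :=
    substSeries (MvPowerSeries.monomial (Finsupp.single () m) (1 : k)) β
  have hγ : ∀ n, IsHS n γ := fun n =>
    (hβ n).substSeries (constantCoeff_monomial_of_ne_zero hμ 1)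
  have hγs : StartsAt m γ := by
    simpa using startsAt_substSeries_monomial hμ (1 : k) β
  have hγm : PowerSeries.coeff m γ = PowerSeries.coeff 1 β := by
    have := coeff_nsmul_substSeries_monomial hμ (1 : k) β 1
    rwa [one_smul, one_pow, one_smul] at this
  refine ⟨fun i => PowerSeries.coeff i γ, (isHS_iff_powerSeries.1 (hγ 0)).1,
    fun i hi0 hi => startsAt_iff_powerSeries.1 hγs i (by omega) hi, hγm, fun i => ?_⟩
  exact defect_single_eq_zero_iff.1 ((isHS_iff_powerSeries.1 (hγ (i + 1))).2 i (by omega))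
end
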